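/- arXiv:2604.23751 — 2 statements merged into one kernel-verified Lean document; each statement's English description precedes it below -/
import Mathlib

section
/- Fix β ∈ ℝ and for each n ≥ 1 let τ_n = τ_n^{β,231} be a Mallows random permutation with parameter e^{β/n} conditioned to avoid 231. Then the random excursions φ_{τ_n} satisfy a large deviation principle on E at speed n with rate function φ ↦ A_β(φ) − inf_{ψ∈E} A_β(ψ), where A_β(φ) := H^{231}(φ) − 2β·∫₀¹ φ(t) dt and H^{231}(φ) := 2·∫₀¹ J(φ'(t)) dt with J(y) := ½(1+y)log(1+y) + ½(1−y)log(1−y) for y ∈ [−1,1] (with 0·log 0 = 0). -/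
open MeasureTheory Filter Set

attribute [local instance] Classical.propDecidable

noncomputable section

/-- Number of inversions of a permutation of `Fin n`. -/
def invCount {n : ℕ} (σ : Equiv.Perm (Fin n)) : ℕ :=
  (Finset.univ.filter (fun p : Fin n × Fin n => p.1 < p.2 ∧ σ p.2 < σ p.1)).card

/-- `σ` avoids the pattern `231`. -/
def Avoids231 {n : ℕ} (σ : Equiv.Perm (Fin n)) : Prop :=
  ¬ ∃ i j k : Fin n, i < j ∧ j < k ∧ σ k < σ i ∧ σ i < σ j

/-- Partition function of the 231-avoiding Mallows model with parameter `e^{β/n}`. -/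
def Z231 (β : ℝ) (n : ℕ) : ℝ :=
  ∑ σ ∈ Finset.univ.filter (fun σ : Equiv.Perm (Fin n) => Avoids231 σ),
    Real.exp (β / n * invCount σ)

/-- A sequence of set functions `p n` (probabilities of events) satisfies a large
deviation principle at speed `n` with rate function `I` (a nonnegative lower
semicontinuous function with values in `[0,∞]`). -/
def SatisfiesLDP {X : Type*} [TopologicalSpace X]
    (p : ℕ → Set X → ENNReal) (I : X → EReal) : Prop :=
  LowerSemicontinuous I ∧ (∀ x, 0 ≤ I x) ∧
  (∀ F : Set X, IsClosed F →
    Filter.limsup (fun n : ℕ => (((n : ℝ)⁻¹ : ℝ) : EReal) * ENNReal.log (p n F))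
      Filter.atTop ≤ - ⨅ x ∈ F, I x) ∧
  (∀ O : Set X, IsOpen O →
    - ⨅ x ∈ O, I x ≤
      Filter.liminf (fun n : ℕ => (((n : ℝ)⁻¹ : ℝ) : EReal) * ENNReal.log (p n O))
        Filter.atTop)

/-- An excursion: a nonnegative `1`-Lipschitz function with `φ(0) = φ(1) = 0`
(defined on `[0,1]` and extended by `0` to `ℝ`). -/
def IsExcursion (φ : BoundedContinuousFunction ℝ ℝ) : Prop :=
  LipschitzWith 1 ⇑φ ∧ (∀ t : ℝ, 0 ≤ φ t) ∧ φ 0 = 0 ∧ φ 1 = 0 ∧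
    ∀ t : ℝ, t ∉ Set.Icc (0:ℝ) 1 → φ t = 0

/-- The space `E` of excursions, equipped with the supremum norm topology. -/
def Espace : Type := {φ : BoundedContinuousFunction ℝ ℝ // IsExcursion φ}

instance : TopologicalSpace Espace := by unfold Espace; infer_instance

/-- `J(y) = ½(1+y)log(1+y) + ½(1−y)log(1−y)`. -/
def Jfun (y : ℝ) : ℝ :=
  (1 + y) * Real.log (1 + y) / 2 + (1 - y) * Real.log (1 - y) / 2

/-- `H^{231}(φ) = 2∫₀¹ J(φ'(t)) dt`, where `φ'` is the almost-everywhere derivative. -/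
def H231 (φ : Espace) : ℝ :=
  2 * ∫ t in (0:ℝ)..1, Jfun (deriv (⇑φ.1) t)

/-- The action `A_β(φ) = H^{231}(φ) − 2β ∫₀¹ φ(t) dt`. -/
def A231 (β : ℝ) (φ : Espace) : ℝ :=
  H231 φ - 2 * β * ∫ t in (0:ℝ)..1, φ.1 t

/-- The (non normalized) RLM curve of a `231`-avoiding permutation, as a function on
`ℝ`. -/
def discF {n : ℕ} (σ : Equiv.Perm (Fin n)) (u : ℝ) : ℝ :=
  if u < n then
    sInf {v : ℝ | ∃ c : Fin n, u < (c : ℕ) + 1 ∧ v = (((σ c : Fin n) : ℕ) : ℝ)}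
  else n

/-- The normalized RLM curve `f_σ(x) = F_σ(nx)/n` of a `231`-avoiding permutation. -/
def fcurve {n : ℕ} (σ : Equiv.Perm (Fin n)) (x : ℝ) : ℝ := discF σ (n * x) / n

/-- The completed graph `{(x,y) : x ∈ [0,1], g(x⁻) ≤ y ≤ g(x)}` of `g`. -/
def completedGraph (g : ℝ → ℝ) : Set (ℝ × ℝ) :=
  {p : ℝ × ℝ | p.1 ∈ Set.Icc (0:ℝ) 1 ∧ p.2 ∈ Set.Icc (Function.leftLim g p.1) (g p.1)}

/-- The rotated-flipped-rescaled graph `{(t + φ(t), t − φ(t)) : t ∈ [0,1]}`. -/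
def excursionGraph (φ : ℝ → ℝ) : Set (ℝ × ℝ) :=
  {q : ℝ × ℝ | ∃ t ∈ Set.Icc (0:ℝ) 1, q = (t + φ t, t - φ t)}

/-- Probability that the Mallows random permutation of size `n` with parameter
`e^{β/n}`, conditioned to avoid `231`, has its excursion in `S`. -/
def probMallows231 (β : ℝ) (phi : ∀ n : ℕ, Equiv.Perm (Fin n) → Espace) (n : ℕ)
    (S : Set Espace) : ENNReal :=
  (∑ σ ∈ Finset.univ.filter
      (fun σ : Equiv.Perm (Fin n) => Avoids231 σ ∧ phi n σ ∈ S),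
    ENNReal.ofReal (Real.exp (β / n * invCount σ))) / ENNReal.ofReal (Z231 β n)

section LocalLDP

variable {X : Type*} [TopologicalSpace X]

theorem inv_mul_log_ofReal_exp {n : ℕ} (hn : 0 < n) (x : ℝ) :
    (((n : ℝ)⁻¹ : ℝ) : EReal) * ENNReal.log (ENNReal.ofReal (Real.exp (n * x))) = (x : EReal) := by
  have hn' : (n : ℝ) ≠ 0 := by positivity
  rw [ENNReal.log_ofReal_of_pos (Real.exp_pos _), Real.log_exp, ← EReal.coe_mul,
    inv_mul_cancel_left₀ hn']

theorem inv_mul_log_le {n : ℕ} (hn : 0 < n) {p : ENNReal} {x : ℝ}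
    (h : p ≤ ENNReal.ofReal (Real.exp (n * x))) :
    (((n : ℝ)⁻¹ : ℝ) : EReal) * ENNReal.log p ≤ (x : EReal) := by
  rw [← inv_mul_log_ofReal_exp hn x]
  exact mul_le_mul_of_nonneg_left (ENNReal.log_le_log h)
    (by exact_mod_cast (by positivity : (0 : ℝ) ≤ (n : ℝ)⁻¹))

theorem le_inv_mul_log {n : ℕ} (hn : 0 < n) {p : ENNReal} {x : ℝ}
    (h : ENNReal.ofReal (Real.exp (n * x)) ≤ p) :
    (x : EReal) ≤ (((n : ℝ)⁻¹ : ℝ) : EReal) * ENNReal.log p := by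
  rw [← inv_mul_log_ofReal_exp hn x]
  exact mul_le_mul_of_nonneg_left (ENNReal.log_le_log h)
    (by exact_mod_cast (by positivity : (0 : ℝ) ≤ (n : ℝ)⁻¹))

theorem eventually_mul_exp_le (K : ℕ) (x : ℝ) {ε : ℝ} (hε : 0 < ε) :
    ∀ᶠ n : ℕ in atTop, (K : ℝ) * Real.exp (n * x) ≤ Real.exp (n * (x + ε)) := by
  have h : Tendsto (fun n : ℕ => Real.exp (n * ε)) atTop atTop :=
    Real.tendsto_exp_atTop.comp (tendsto_natCast_atTop_atTop.atTop_mul_const hε)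
  filter_upwards [h.eventually_ge_atTop (K : ℝ)] with n hn
  rw [mul_add, Real.exp_add, mul_comm]
  exact mul_le_mul_of_nonneg_left hn (Real.exp_pos _).le

/-- Local exponential upper bounds for a subadditive set function yield the same upper bound on
compact sets. -/
theorem IsCompact.eventually_le_exp {W : ℕ → Set X → ℝ}
    (hmono : ∀ n S T, S ⊆ T → W n S ≤ W n T)
    (hsub : ∀ n S T, W n (S ∪ T) ≤ W n S + W n T) (hempty : ∀ n, W n ∅ = 0)
    {F : Set X} (hF : IsCompact F) (b : ℝ)
    (hloc : ∀ x ∈ F, ∀ ε > 0, ∃ U ∈ nhds x, ∀ᶠ n : ℕ in atTop, W n U ≤ Real.exp (n * (b + ε)))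
    {ε : ℝ} (hε : 0 < ε) :
    ∀ᶠ n : ℕ in atTop, W n F ≤ Real.exp (n * (b + ε)) := by
  have key : ∃ K : ℕ, ∀ᶠ n : ℕ in atTop, W n F ≤ K * Real.exp (n * (b + ε / 2)) := by
    refine hF.induction_on (p := fun S => ∃ K : ℕ, ∀ᶠ n : ℕ in atTop,
      W n S ≤ K * Real.exp (n * (b + ε / 2))) ?_ ?_ ?_ ?_
    · exact ⟨0, Eventually.of_forall fun n => by simp [hempty]⟩
    · rintro S T hST ⟨K, hK⟩
      exact ⟨K, hK.mono fun n hn => (hmono n S T hST).trans hn⟩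
    · rintro S T ⟨K, hK⟩ ⟨K', hK'⟩
      refine ⟨K + K', ?_⟩
      filter_upwards [hK, hK'] with n h1 h2
      push_cast
      linarith [hsub n S T]
    · intro x hx
      obtain ⟨U, hU, h⟩ := hloc x hx (ε / 2) (by positivity)
      exact ⟨U, mem_nhdsWithin_of_mem_nhds hU, 1, by simpa using h⟩
  obtain ⟨K, hK⟩ := key
  filter_upwards [hK, eventually_mul_exp_le K (b + ε / 2) (half_pos hε)] with n h1 h2
  refine (h1.trans h2).trans_eq ?_
  congr 2; ring

/-- Local exponential upper and lower bounds on a compact space yield a large deviation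
principle for the normalized set functions. -/
theorem satisfiesLDP_of_local [CompactSpace X] [Nonempty X] {W : ℕ → Set X → ℝ}
    (hmono : ∀ n S T, S ⊆ T → W n S ≤ W n T)
    (hsub : ∀ n S T, W n (S ∪ T) ≤ W n S + W n T) (hempty : ∀ n, W n ∅ = 0)
    (A : X → ℝ) (C : ℝ)
    (hU : ∀ x, ∀ ε > 0, ∃ U ∈ nhds x, ∀ᶠ n : ℕ in atTop,
      W n U ≤ Real.exp (n * (C - A x + ε)))
    (hL : ∀ x, ∀ U ∈ nhds x, ∀ ε > 0, ∀ᶠ n : ℕ in atTop,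
      Real.exp (n * (C - A x - ε)) ≤ W n U) :
    SatisfiesLDP (fun n S => ENNReal.ofReal (W n S) / ENNReal.ofReal (W n univ))
      (fun x => ((A x - ⨅ y, A y : ℝ) : EReal)) := by
  have lsc : LowerSemicontinuous A := by
    intro x a ha
    obtain ⟨U, hUx, hUn⟩ := hU x ((A x - a) / 3) (by linarith)
    filter_upwards [eventually_mem_nhds_iff.2 hUx] with y hy
    obtain ⟨n, h1, h2, h3⟩ := (hUn.and ((hL y U hy ((A x - a) / 3) (by linarith)).and
      (eventually_gt_atTop 0))).exists
    have := Real.exp_le_exp.1 (h2.trans h1)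
    have := le_of_mul_le_mul_left this (by exact_mod_cast h3)
    linarith
  obtain ⟨x₀, -, hx₀⟩ := (lsc.lowerSemicontinuousOn univ).exists_isMinOn univ_nonempty
    isCompact_univ
  have hmin : ∀ y, A x₀ ≤ A y := fun y => hx₀ (mem_univ y)
  have hinf : (⨅ y, A y) = A x₀ :=
    le_antisymm (ciInf_le ⟨A x₀, by rintro _ ⟨y, rfl⟩; exact hmin y⟩ x₀) (le_ciInf hmin)
  rw [hinf]
  refine ⟨?_, ?_, ?_, ?_⟩
  · exact Continuous.comp_lowerSemicontinuous
      (g := fun r : ℝ => ((r - A x₀ : ℝ) : EReal)) 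
      (continuous_coe_real_ereal.comp (continuous_id.sub continuous_const)) lsc
      (fun a b h => by
        have : a - A x₀ ≤ b - A x₀ := by linarith
        exact EReal.coe_le_coe_iff.2 this)
  · intro x
    exact EReal.coe_nonneg.2 (sub_nonneg.2 (hmin x))
  · intro F hF
    rcases F.eq_empty_or_nonempty with rfl | hne
    · refine limsup_le_of_le (by isBoundedDefault) ?_
      filter_upwards [eventually_gt_atTop 0] with n hn
      have : (0 : ℝ) < (n : ℝ)⁻¹ := by positivity
      simp [hempty, EReal.coe_mul_bot_of_pos this]
    · obtain ⟨z, hz, hzmin⟩ := (lsc.lowerSemicontinuousOn F).exists_isMinOn hne hF.isCompact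
      have h1 : -((A z - A x₀ : ℝ) : EReal) ≤ -⨅ x ∈ F, ((A x - A x₀ : ℝ) : EReal) :=
        EReal.neg_le_neg_iff.2 (iInf₂_le z hz)
      refine le_trans ?_ h1
      rw [← EReal.coe_neg]
      refine EReal.le_of_forall_lt_iff_le.1 fun r hr => ?_
      have hr' : 0 < r + (A z - A x₀) := by
        have : -(A z - A x₀) < r := by exact_mod_cast hr
        linarith
      refine limsup_le_of_le (by isBoundedDefault) ?_
      have hFn := IsCompact.eventually_le_exp hmono hsub hempty hF.isCompact (C - A z)
        (fun x hx ε hε => by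
          obtain ⟨U, hUx, h⟩ := hU x ε hε
          refine ⟨U, hUx, h.mono fun n hn => hn.trans (Real.exp_le_exp.2 ?_)⟩
          have : A z ≤ A x := hzmin hx
          gcongr) (half_pos hr')
      filter_upwards [eventually_gt_atTop 0, hFn, hL x₀ univ univ_mem _ (half_pos hr')]
        with n hn h1 h2
      refine inv_mul_log_le hn ?_
      rw [← ENNReal.ofReal_div_of_pos ((Real.exp_pos _).trans_le h2)]
      refine ENNReal.ofReal_le_ofReal ?_
      rw [div_le_iff₀ ((Real.exp_pos _).trans_le h2)]
      refine h1.trans ?_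
      refine le_trans (le_of_eq ?_) (mul_le_mul_of_nonneg_left h2 (Real.exp_pos _).le)
      rw [← Real.exp_add]
      congr 1; ring
  · intro O hO
    rw [EReal.neg_le]
    refine le_iInf₂ fun x hx => ?_
    rw [EReal.neg_le, ← EReal.coe_neg]
    refine EReal.ge_of_forall_gt_iff_ge.1 fun r hr => ?_
    have hr' : 0 < -(A x - A x₀) - r := by
      have : r < -(A x - A x₀) := by exact_mod_cast hr
      linarith
    refine le_liminf_of_le (by isBoundedDefault) ?_
    have hFn := IsCompact.eventually_le_exp hmono hsub hempty isCompact_univ (C - A x₀)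
        (fun x hx ε hε => by
          obtain ⟨U, hUx, h⟩ := hU x ε hε
          refine ⟨U, hUx, h.mono fun n hn => hn.trans (Real.exp_le_exp.2 ?_)⟩
          have : A x₀ ≤ A x := hmin x
          gcongr) (half_pos hr')
    filter_upwards [eventually_gt_atTop 0, hFn, hL x O (hO.mem_nhds hx) _ (half_pos hr')]
        with n hn h1 h2
    have h3 : 0 < W n univ := (Real.exp_pos _).trans_le (h2.trans (hmono n _ _ (subset_univ O)))
    refine le_inv_mul_log hn ?_
    rw [← ENNReal.ofReal_div_of_pos h3]
    refine ENNReal.ofReal_le_ofReal ?_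
    rw [le_div_iff₀ h3]
    refine le_trans ?_ h2
    refine (mul_le_mul_of_nonneg_left h1 (Real.exp_pos _).le).trans (le_of_eq ?_)
    rw [← Real.exp_add]
    congr 1; ring

end LocalLDP

namespace Espace

theorem isInducing_val : Topology.IsInducing (fun φ : Espace => φ.1) := ⟨rfl⟩

theorem exists_forall_dist_le_mem {φ : Espace} {U : Set Espace} (hU : U ∈ nhds φ) :
    ∃ δ > 0, ∀ ψ : Espace, dist ψ.1 φ.1 ≤ δ → ψ ∈ U := by
  rw [isInducing_val.nhds_eq_comap, mem_comap] at hU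
  obtain ⟨V, hV, hVU⟩ := hU
  obtain ⟨ε, hε, h⟩ := Metric.mem_nhds_iff.1 hV
  exact ⟨ε / 2, half_pos hε, fun ψ hψ => hVU (h (lt_of_le_of_lt hψ (half_lt_self hε)))⟩

theorem closedBall_mem_nhds (φ : Espace) {δ : ℝ} (hδ : 0 < δ) :
    {ψ : Espace | dist ψ.1 φ.1 ≤ δ} ∈ nhds φ := by
  rw [isInducing_val.nhds_eq_comap]
  exact preimage_mem_comap (Metric.closedBall_mem_nhds φ.1 hδ)

theorem lipschitz (φ : Espace) : LipschitzWith 1 ⇑φ.1 := φ.2.1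

theorem abs_sub_le (φ : Espace) (s t : ℝ) : |φ.1 s - φ.1 t| ≤ |s - t| := by
  simpa [Real.dist_eq] using φ.lipschitz.dist_le_mul s t

theorem nonneg (φ : Espace) (t : ℝ) : 0 ≤ φ.1 t := φ.2.2.1 t

theorem apply_zero (φ : Espace) : φ.1 0 = 0 := φ.2.2.2.1

theorem apply_one (φ : Espace) : φ.1 1 = 0 := φ.2.2.2.2.1

theorem apply_of_notMem (φ : Espace) {t : ℝ} (ht : t ∉ Icc (0 : ℝ) 1) : φ.1 t = 0 :=
  φ.2.2.2.2.2 t ht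

theorem apply_le_one (φ : Espace) (t : ℝ) : φ.1 t ≤ 1 := by
  by_cases ht : t ∈ Icc (0 : ℝ) 1
  · have := φ.abs_sub_le t 0
    rw [φ.apply_zero, sub_zero, sub_zero, abs_of_nonneg ht.1] at this
    linarith [le_abs_self (φ.1 t), ht.2]
  · rw [φ.apply_of_notMem ht]; norm_num

instance : Nonempty Espace :=
  ⟨⟨0, LipschitzWith.const' (0 : ℝ), by simp, by simp, by simp, by simp⟩⟩

open BoundedContinuousFunction in
instance : CompactSpace Espace := by
  suffices h : IsCompact {φ : BoundedContinuousFunction ℝ ℝ | IsExcursion φ} from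
    isCompact_iff_compactSpace.1 h
  have h0 : (0 : ℝ) ∈ Icc (0 : ℝ) 1 := by simp
  have h1 : (1 : ℝ) ∈ Icc (0 : ℝ) 1 := by simp
  let K : Set (BoundedContinuousFunction (Icc (0 : ℝ) 1) ℝ) :=
    {g | (∀ s t, dist (g s) (g t) ≤ dist s t) ∧ (∀ t, 0 ≤ g t) ∧ g ⟨0, h0⟩ = 0 ∧ g ⟨1, h1⟩ = 0}
  have hK : IsCompact K := by
    refine arzela_ascoli₂ (Icc 0 1) isCompact_Icc K ?_ ?_ ?_
    · have e : ∀ t, Continuous fun g : BoundedContinuousFunction (Icc (0 : ℝ) 1) ℝ => g t :=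
        fun t => continuous_eval_const (x := t)
      simp only [K, ofPred_and, ofPred_forall]
      refine IsClosed.inter ?_ (IsClosed.inter ?_ (IsClosed.inter ?_ ?_))
      · exact isClosed_iInter fun s => isClosed_iInter fun t =>
          isClosed_le ((e s).dist (e t)) continuous_const
      · exact isClosed_iInter fun s => isClosed_le continuous_const (e s)
      · exact isClosed_eq (e _) continuous_const
      · exact isClosed_eq (e _) continuous_const
    · rintro g t ⟨hg, hp, hz, -⟩
      refine ⟨hp t, ?_⟩
      have := hg t ⟨0, h0⟩
      rw [hz, Real.dist_eq, sub_zero, Subtype.dist_eq, Real.dist_eq] at this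
      simp only [sub_zero, abs_of_nonneg t.2.1] at this
      linarith [le_abs_self (g t), t.2.2]
    · refine (LipschitzWith.uniformEquicontinuous _ 1 fun g => ?_).equicontinuous
      exact LipschitzWith.of_dist_le_mul fun s t => by simpa using g.2.1 s t
  let p : C(ℝ, Icc (0 : ℝ) 1) := ⟨projIcc 0 1 zero_le_one, continuous_projIcc⟩
  convert hK.image (f := fun g => g.compContinuous p) (continuous_compContinuous p) using 1
  ext φ
  constructor
  · intro hφ
    let r : C(Icc (0 : ℝ) 1, ℝ) := ⟨Subtype.val, continuous_subtype_val⟩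
    refine ⟨φ.compContinuous r, ⟨?_, fun t => hφ.2.1 t, hφ.2.2.1, hφ.2.2.2.1⟩, ?_⟩
    · intro s t
      have := hφ.1.dist_le_mul (s : ℝ) t
      rwa [NNReal.coe_one, one_mul] at this
    · ext t
      change φ (projIcc (0 : ℝ) 1 zero_le_one t : ℝ) = φ t
      by_cases ht : t ∈ Icc (0 : ℝ) 1
      · rw [projIcc_of_mem _ ht]
      · rw [hφ.2.2.2.2 t ht]
        rcases not_and_or.1 ht with h | h
        · rw [projIcc_of_le_left _ (not_le.1 h).le]; exact hφ.2.2.1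
        · rw [projIcc_of_right_le _ (not_le.1 h).le]; exact hφ.2.2.2.1
  · rintro ⟨g, ⟨hg, hp, hz, ho⟩, rfl⟩
    refine ⟨?_, fun t => hp _, ?_, ?_, ?_⟩
    · refine LipschitzWith.of_dist_le_mul fun s t => ?_
      refine (hg _ _).trans ?_
      have := (LipschitzWith.projIcc (zero_le_one' ℝ)).dist_le_mul s t
      rw [NNReal.coe_one, one_mul] at this ⊢
      exact this
    · change g (projIcc (0 : ℝ) 1 zero_le_one 0) = 0
      rw [projIcc_left]; exact hz
    · change g (projIcc (0 : ℝ) 1 zero_le_one 1) = 0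
      rw [projIcc_right]; exact ho
    · intro t ht
      change g (projIcc (0 : ℝ) 1 zero_le_one t) = 0
      rcases not_and_or.1 ht with h | h
      · rw [projIcc_of_le_left _ (not_le.1 h).le]; exact hz
      · rw [projIcc_of_right_le _ (not_le.1 h).le]; exact ho

end Espace

theorem continuous_Jfun : Continuous Jfun := by
  have h1 : Continuous fun y : ℝ => (1 + y) * Real.log (1 + y) :=
    Real.continuous_mul_log.comp (continuous_const.add continuous_id)
  have h2 : Continuous fun y : ℝ => (1 - y) * Real.log (1 - y) :=
    Real.continuous_mul_log.comp (continuous_const.sub continuous_id)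
  exact (h1.div_const 2).add (h2.div_const 2)

theorem Jfun_neg (y : ℝ) : Jfun (-y) = Jfun y := by
  simp only [Jfun, sub_neg_eq_add, ← sub_eq_add_neg]
  ring

theorem exists_le_mul_sub_log_cosh_one {ε : ℝ} (hε : 0 < ε) :
    ∃ l : ℝ, Jfun 1 - ε ≤ l - Real.log (Real.cosh l) := by
  refine ⟨Real.log (ε⁻¹) / 2, ?_⟩
  set l := Real.log (ε⁻¹) / 2 with hl
  have hJ : Jfun 1 = Real.log 2 := by
    simp only [Jfun]; norm_num
  have h2 : Real.exp (-(2 * l)) = ε := by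
    rw [hl, mul_div_cancel₀ _ two_ne_zero, Real.log_inv, neg_neg, Real.exp_log hε]
  have hc : Real.cosh l = Real.exp l * ((1 + ε) / 2) := by
    rw [Real.cosh_eq, ← h2, show -l = l + -(2 * l) by ring, Real.exp_add]; ring
  rw [hc, Real.log_mul (Real.exp_pos _).ne' (by positivity), Real.log_exp,
    Real.log_div (by positivity) two_ne_zero, hJ]
  linarith [Real.log_le_sub_one_of_pos (by positivity : 0 < 1 + ε)]

/-- `J` is the Legendre transform of `log cosh` on `[-1, 1]`. -/
theorem exists_Jfun_sub_le {y : ℝ} (hy : |y| ≤ 1) {ε : ℝ} (hε : 0 < ε) :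
    ∃ l : ℝ, Jfun y - ε ≤ l * y - Real.log (Real.cosh l) := by
  obtain ⟨hy1, hy2⟩ := abs_le.1 hy
  rcases hy2.eq_or_lt with rfl | hy2
  · obtain ⟨l, hl⟩ := exists_le_mul_sub_log_cosh_one hε
    exact ⟨l, by simpa using hl⟩
  rcases hy1.eq_or_lt with rfl | hy1
  · obtain ⟨l, hl⟩ := exists_le_mul_sub_log_cosh_one hε
    exact ⟨-l, by simpa [Jfun_neg] using hl⟩
  set a := Real.log (1 + y) with ha
  set b := Real.log (1 - y) with hb
  refine ⟨(a - b) / 2, ?_⟩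
  have hea : Real.exp a = 1 + y := Real.exp_log (by linarith)
  have heb : Real.exp b = 1 - y := Real.exp_log (by linarith)
  have hc : Real.cosh ((a - b) / 2) = Real.exp (-((a + b) / 2)) := by
    rw [Real.cosh_eq, show (a - b) / 2 = -((a + b) / 2) + a by ring,
      show -(-((a + b) / 2) + a) = -((a + b) / 2) + b by ring, Real.exp_add, Real.exp_add,
      hea, heb]
    ring
  rw [hc, Real.log_exp, Jfun, ← ha, ← hb]
  linarith

theorem factorial_add_le_factorial_mul_pow (c m : ℕ) :
    (c + m).factorial ≤ c.factorial * (c + m) ^ m := by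
  rw [← Nat.factorial_mul_ascFactorial]
  exact Nat.mul_le_mul_left _ (Nat.ascFactorial_le_pow_add c m)

theorem choose_mul_pow_mul_pow_le (a b k : ℕ) (hk : k ≤ a + b) :
    (a + b).choose k * (a ^ k * b ^ (a + b - k)) ≤ (a + b).choose a * (a ^ a * b ^ b) := by
  have h1 : (a + b).choose k * (k.factorial * (a + b - k).factorial) = (a + b).factorial := by
    rw [← mul_assoc]; exact Nat.choose_mul_factorial_mul_factorial hk
  have h2 : (a + b).choose a * (a.factorial * b.factorial) = (a + b).factorial := by
    rw [← mul_assoc]; simpa using Nat.choose_mul_factorial_mul_factorial (Nat.le_add_right a b)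
  have key : a.factorial * b.factorial * (a ^ k * b ^ (a + b - k)) ≤
      k.factorial * (a + b - k).factorial * (a ^ a * b ^ b) := by
    rcases le_total a k with h | h
    · obtain ⟨m, rfl⟩ := Nat.exists_eq_add_of_le h
      obtain ⟨c, rfl⟩ : ∃ c, b = c + m := ⟨b - m, by omega⟩
      have e : a + (c + m) - (a + m) = c := by omega
      rw [e, pow_add, pow_add]
      have i1 : a.factorial * a ^ m ≤ (a + m).factorial :=
        (Nat.mul_le_mul_left _ (Nat.pow_le_pow_left (Nat.le_succ a) m)).trans
          Nat.factorial_mul_pow_le_factorial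
      have i2 : (c + m).factorial ≤ c.factorial * (c + m) ^ m :=
        factorial_add_le_factorial_mul_pow c m
      calc _ = (a.factorial * a ^ m) * (c + m).factorial * (a ^ a * (c + m) ^ c) := by ring
        _ ≤ (a + m).factorial * (c.factorial * (c + m) ^ m) * (a ^ a * (c + m) ^ c) := by gcongr
        _ = _ := by ring
    · obtain ⟨m, rfl⟩ := Nat.exists_eq_add_of_le h
      have e : k + m + b - k = b + m := by omega
      rw [e, pow_add, pow_add]
      have i1 : b.factorial * b ^ m ≤ (b + m).factorial :=
        (Nat.mul_le_mul_left _ (Nat.pow_le_pow_left (Nat.le_succ b) m)).trans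
          Nat.factorial_mul_pow_le_factorial
      have i2 : (k + m).factorial ≤ k.factorial * (k + m) ^ m :=
        factorial_add_le_factorial_mul_pow k m
      calc _ = (b.factorial * b ^ m) * (k + m).factorial * ((k + m) ^ k * b ^ b) := by ring
        _ ≤ (b + m).factorial * (k.factorial * (k + m) ^ m) * ((k + m) ^ k * b ^ b) := by gcongr
        _ = _ := by ring
  refine Nat.le_of_mul_le_mul_left (c := a.factorial * b.factorial *
    (k.factorial * (a + b - k).factorial)) ?_ (by positivity)
  calc _ = ((a + b).choose k * (k.factorial * (a + b - k).factorial)) *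
        (a.factorial * b.factorial * (a ^ k * b ^ (a + b - k))) := by ring
    _ ≤ ((a + b).choose k * (k.factorial * (a + b - k).factorial)) *
        (k.factorial * (a + b - k).factorial * (a ^ a * b ^ b)) := by gcongr
    _ = ((a + b).choose a * (a.factorial * b.factorial)) *
        (k.factorial * (a + b - k).factorial * (a ^ a * b ^ b)) := by rw [h1, h2]
    _ = _ := by ring

theorem add_pow_le_succ_mul_choose (a b : ℕ) :
    (a + b) ^ (a + b) ≤ (a + b + 1) * ((a + b).choose a * (a ^ a * b ^ b)) := by
  rw [add_pow]
  refine (Finset.sum_le_card_nsmul _ _ ((a + b).choose a * (a ^ a * b ^ b)) ?_).trans (by simp)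
  intro k hk
  have hk' : k ≤ a + b := Nat.lt_succ_iff.1 (Finset.mem_range.1 hk)
  rw [mul_comm]
  exact choose_mul_pow_mul_pow_le a b k hk'

/-- Entropy lower bound for binomial coefficients. -/
theorem entropy_le_log_choose {l a : ℕ} (hl : 0 < l) (ha : a ≤ 2 * l) :
    2 * l * (Real.log 2 - Jfun (((a : ℝ) - l) / l)) - Real.log (2 * l + 1) ≤
      Real.log ((2 * l).choose a) := by
  obtain ⟨b, hb⟩ := Nat.exists_eq_add_of_le ha
  have hl' : (0 : ℝ) < l := by exact_mod_cast hl
  have hbR : (2 : ℝ) * l = a + b := by exact_mod_cast hb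
  have hch : 0 < (2 * l).choose a := Nat.choose_pos ha
  have h := add_pow_le_succ_mul_choose a b
  rw [← hb] at h
  have hself : ∀ c : ℕ, 0 < ((c : ℝ) ^ c) := fun c => by
    rcases Nat.eq_zero_or_pos c with rfl | hc
    · simp
    · positivity
  have h' : ((2 * l : ℕ) : ℝ) ^ (2 * l) ≤
      ((2 * l : ℕ) + 1 : ℝ) * (((2 * l).choose a : ℝ) * ((a : ℝ) ^ a * (b : ℝ) ^ b)) := by
    exact_mod_cast h
  have hlog := Real.log_le_log (hself _) h'
  have hc0 : (((2 * l).choose a : ℕ) : ℝ) ≠ 0 := by positivity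
  rw [Real.log_mul (by positivity) (mul_ne_zero hc0 (mul_ne_zero (hself a).ne' (hself b).ne')),
    Real.log_mul hc0 (mul_ne_zero (hself a).ne' (hself b).ne'),
    Real.log_mul (hself a).ne' (hself b).ne', Real.log_pow, Real.log_pow, Real.log_pow] at hlog
  push_cast at hlog
  rw [Real.log_mul two_ne_zero hl'.ne'] at hlog
  have hx : ∀ c : ℕ, (c : ℝ) * Real.log (c / l) = c * Real.log c - c * Real.log l := fun c => by
    rcases Nat.eq_zero_or_pos c with rfl | hc
    · simp
    · rw [Real.log_div (by positivity) hl'.ne']; ring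
  have e1 : 1 + ((a : ℝ) - l) / l = a / l := by field_simp; ring
  have e2 : 1 - ((a : ℝ) - l) / l = b / l := by field_simp; linarith
  have hJ : 2 * l * Jfun (((a : ℝ) - l) / l) =
      a * Real.log (a / l) + b * Real.log (b / l) := by
    rw [Jfun, e1, e2]; field_simp
  rw [mul_sub, hJ, hx, hx]
  have : (a : ℝ) * Real.log l + b * Real.log l = 2 * l * Real.log l := by rw [hbR]; ring
  linarith

/-- The average over `M` equal blocks of `J` applied to the slope of `φ` over the block. -/
def blockEntropy (φ : ℝ → ℝ) (M : ℕ) : ℝ :=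
  (∑ i ∈ Finset.range M, Jfun (M * (φ ((i + 1 : ℕ) / M) - φ ((i : ℕ) / M)))) / M

theorem HasDerivAt.tendsto_mul_sub_floor {φ : ℝ → ℝ} {t d : ℝ} (h : HasDerivAt φ d t)
    (ht : 0 ≤ t) :
    Tendsto (fun M : ℕ => (M : ℝ) * (φ ((⌊M * t⌋₊ + 1 : ℕ) / M) - φ ((⌊M * t⌋₊ : ℕ) / M)))
      atTop (nhds d) := by
  rw [Metric.tendsto_atTop]
  intro ε hε
  have h' := (hasDerivAt_iff_isLittleO.1 h).def (c := ε / 4) (by positivity)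
  obtain ⟨η, hη, hb⟩ := Metric.eventually_nhds_iff.1 h'
  obtain ⟨N, hN⟩ := exists_nat_gt (1 / η)
  refine ⟨N + 1, fun M hM => ?_⟩
  have hM0 : (0 : ℝ) < M := by
    have : 0 < M := by omega
    exact_mod_cast this
  have hMη : 1 / (M : ℝ) < η := by
    rw [div_lt_iff₀ hM0, ← div_lt_iff₀' hη]
    exact hN.trans_le (by exact_mod_cast (by omega : N ≤ M))
  have f1 : (⌊M * t⌋₊ : ℝ) ≤ M * t := Nat.floor_le (by positivity)
  have f2 : M * t < ⌊M * t⌋₊ + 1 := Nat.lt_floor_add_one _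
  set k := ⌊M * t⌋₊
  have a1 : |(k : ℝ) / M - t| ≤ 1 / M := by
    rw [abs_le, div_sub' hM0.ne']
    constructor
    · rw [← neg_div]; gcongr; linarith
    · gcongr; linarith
  have a2 : |((k + 1 : ℕ) : ℝ) / M - t| ≤ 1 / M := by
    rw [abs_le, div_sub' hM0.ne']
    push_cast
    constructor
    · rw [← neg_div]; gcongr; linarith
    · gcongr; linarith
  have b1 := hb (show dist ((k : ℝ) / M) t < η from a1.trans_lt hMη)
  have b2 := hb (show dist (((k + 1 : ℕ) : ℝ) / M) t < η from a2.trans_lt hMη)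
  rw [Real.norm_eq_abs, Real.norm_eq_abs, smul_eq_mul] at b1 b2
  have c1 := b1.trans (mul_le_mul_of_nonneg_left a1 (by positivity))
  have c2 := b2.trans (mul_le_mul_of_nonneg_left a2 (by positivity))
  rw [Real.dist_eq]
  have e : (M : ℝ) * (φ ((k + 1 : ℕ) / M) - φ ((k : ℕ) / M)) - d =
      M * ((φ ((k + 1 : ℕ) / M) - φ t - (((k + 1 : ℕ) : ℝ) / M - t) * d) -
        (φ ((k : ℕ) / M) - φ t - ((k : ℝ) / M - t) * d)) := by
    push_cast; field_simp; ring
  rw [e, abs_mul, abs_of_pos hM0]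
  calc (M : ℝ) * _ ≤ M * (ε / 4 * (1 / M) + ε / 4 * (1 / M)) := by
        gcongr; exact (abs_sub _ _).trans (add_le_add c2 c1)
    _ = ε / 2 := by field_simp; ring
    _ < ε := by linarith

theorem blockEntropy_eq_integral (φ : ℝ → ℝ) {M : ℕ} (hM : 0 < M) :
    blockEntropy φ M = ∫ t in (0 : ℝ)..1,
      Jfun (M * (φ ((⌊M * t⌋₊ + 1 : ℕ) / M) - φ ((⌊M * t⌋₊ : ℕ) / M))) := by
  have hM0 : (0 : ℝ) < M := by exact_mod_cast hM
  set g : ℝ → ℝ := fun t => Jfun (M * (φ ((⌊M * t⌋₊ + 1 : ℕ) / M) - φ ((⌊M * t⌋₊ : ℕ) / M)))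
  set c : ℕ → ℝ := fun i => Jfun (M * (φ ((i + 1 : ℕ) / M) - φ ((i : ℕ) / M)))
  have hlt : ∀ i : ℕ, (i : ℝ) / M ≤ ((i + 1 : ℕ) : ℝ) / M := fun i => by
    gcongr; exact Nat.le_succ i
  have hae : ∀ i : ℕ, ∀ᵐ t, t ∈ uIoc ((i : ℝ) / M) ((i + 1 : ℕ) / M) → c i = g t := fun i => by
    have : ∀ᵐ t : ℝ, t ≠ ((i + 1 : ℕ) : ℝ) / M := by simp [ae_iff, measure_singleton]
    filter_upwards [this] with t ht htI
    rw [uIoc_of_le (hlt i)] at htI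
    have h2 : t < ((i + 1 : ℕ) : ℝ) / M := lt_of_le_of_ne htI.2 ht
    have h1 := htI.1
    rw [lt_div_iff₀ hM0] at h2
    rw [div_lt_iff₀ hM0] at h1
    have : ⌊(M : ℝ) * t⌋₊ = i := by
      rw [Nat.floor_eq_iff (by nlinarith [(Nat.cast_nonneg i : (0 : ℝ) ≤ i)])]
      push_cast at h2
      constructor <;> linarith
    simp only [g, c, this]
  have hI : ∀ i : ℕ, IntervalIntegrable g volume ((i : ℝ) / M) ((i + 1 : ℕ) / M) := fun i =>
    (intervalIntegrable_const (c := c i)).congr_ae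
      ((ae_restrict_iff' measurableSet_uIoc).2 (hae i))
  have hs := intervalIntegral.sum_integral_adjacent_intervals
    (a := fun i : ℕ => (i : ℝ) / M) (f := g) (μ := volume) (n := M) fun i _ => hI i
  simp only [Nat.cast_zero, zero_div, div_self hM0.ne'] at hs
  rw [← hs, blockEntropy, Finset.sum_div]
  refine Finset.sum_congr rfl fun i _ => ?_
  rw [← intervalIntegral.integral_congr_ae (hae i), intervalIntegral.integral_const,
    smul_eq_mul, ← sub_div, Nat.cast_succ, add_sub_cancel_left, one_div, inv_mul_eq_div,
    ← Nat.cast_succ]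

theorem abs_mul_sub_le_one {φ : ℝ → ℝ} (hφ : LipschitzWith 1 φ) (M i : ℕ) :
    |(M : ℝ) * (φ ((i + 1 : ℕ) / M) - φ ((i : ℕ) / M))| ≤ 1 := by
  rcases Nat.eq_zero_or_pos M with rfl | hM
  · simp
  have hM0 : (0 : ℝ) < M := by exact_mod_cast hM
  have := hφ.dist_le_mul (((i + 1 : ℕ) : ℝ) / M) ((i : ℝ) / M)
  rw [Real.dist_eq, Real.dist_eq, NNReal.coe_one, one_mul, ← sub_div] at this
  push_cast at this
  rw [add_sub_cancel_left, abs_of_pos (by positivity : 0 < 1 / (M : ℝ))] at this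
  rw [abs_mul, abs_of_pos hM0]
  push_cast
  calc (M : ℝ) * _ ≤ M * (1 / M) := by gcongr
    _ = 1 := by field_simp

theorem tendsto_blockEntropy {φ : ℝ → ℝ} (hφ : LipschitzWith 1 φ) :
    Tendsto (blockEntropy φ) atTop (nhds (∫ t in (0 : ℝ)..1, Jfun (deriv φ t))) := by
  obtain ⟨B, hB⟩ := isCompact_Icc.exists_bound_of_continuousOn
    (continuous_Jfun.continuousOn (s := Icc (-1 : ℝ) 1))
  have h : Tendsto (fun M : ℕ => ∫ t in (0 : ℝ)..1,
      Jfun (M * (φ ((⌊M * t⌋₊ + 1 : ℕ) / M) - φ ((⌊M * t⌋₊ : ℕ) / M)))) atTop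
      (nhds (∫ t in (0 : ℝ)..1, Jfun (deriv φ t))) := by
    refine intervalIntegral.tendsto_integral_filter_of_dominated_convergence (fun _ => B)
      (Eventually.of_forall fun M => ?_) (Eventually.of_forall fun M => ?_)
      intervalIntegrable_const ?_
    · refine Measurable.aestronglyMeasurable ?_
      refine continuous_Jfun.measurable.comp (Measurable.const_mul ?_ _)
      have hf : Measurable fun t : ℝ => ⌊(M : ℝ) * t⌋₊ :=
        Nat.measurable_floor.comp (measurable_const_mul _)
      exact (measurable_from_nat (f := fun k : ℕ => φ ((k + 1 : ℕ) / M) - φ ((k : ℕ) / M))).comp hf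
    · exact Eventually.of_forall fun t _ => hB _ (abs_le.1 (abs_mul_sub_le_one hφ M _))
    · filter_upwards [hφ.ae_differentiableAt_real] with t ht htI
      rw [uIoc_of_le zero_le_one] at htI
      exact (continuous_Jfun.tendsto _).comp (ht.hasDerivAt.tendsto_mul_sub_floor htI.1.le)
  refine h.congr' ?_
  filter_upwards [eventually_gt_atTop 0] with M hM
  exact (blockEntropy_eq_integral φ hM).symm

section MinFrom

variable {n : ℕ}

/-- The least value (counted from `0`) taken by `σ` at a position `≥ k`, or `n` if there is no such
position. -/
def minFrom (σ : Equiv.Perm (Fin n)) (k : ℕ) : ℕ :=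
  sInf {v : ℕ | (∃ c : Fin n, k ≤ c ∧ (σ c : ℕ) = v) ∨ v = n}

theorem minFrom_mem (σ : Equiv.Perm (Fin n)) (k : ℕ) :
    (∃ c : Fin n, k ≤ c ∧ (σ c : ℕ) = minFrom σ k) ∨ minFrom σ k = n :=
  Nat.sInf_mem (s := {v : ℕ | (∃ c : Fin n, k ≤ c ∧ (σ c : ℕ) = v) ∨ v = n}) ⟨n, Or.inr rfl⟩

theorem minFrom_le (σ : Equiv.Perm (Fin n)) (k : ℕ) : minFrom σ k ≤ n :=
  Nat.sInf_le (Or.inr rfl)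

theorem minFrom_le_apply (σ : Equiv.Perm (Fin n)) {k : ℕ} {c : Fin n} (h : k ≤ c) :
    minFrom σ k ≤ σ c :=
  Nat.sInf_le (Or.inl ⟨c, h, rfl⟩)

theorem exists_apply_eq_minFrom (σ : Equiv.Perm (Fin n)) {k : ℕ} (hk : k < n) :
    ∃ c : Fin n, k ≤ c ∧ (σ c : ℕ) = minFrom σ k := by
  rcases minFrom_mem σ k with h | h
  · exact h
  · have := minFrom_le_apply σ (k := k) (c := ⟨k, hk⟩) le_rfl
    have := (σ ⟨k, hk⟩).isLt
    omega

theorem minFrom_lt (σ : Equiv.Perm (Fin n)) {k : ℕ} (hk : k < n) : minFrom σ k < n := by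
  obtain ⟨c, -, hc⟩ := exists_apply_eq_minFrom σ hk
  exact hc ▸ (σ c).isLt

theorem minFrom_of_le (σ : Equiv.Perm (Fin n)) {k : ℕ} (hk : n ≤ k) : minFrom σ k = n := by
  rcases minFrom_mem σ k with ⟨c, hc, -⟩ | h
  · exact absurd c.isLt (by omega)
  · exact h

theorem minFrom_mono (σ : Equiv.Perm (Fin n)) : Monotone (minFrom σ) := by
  intro a b hab
  rcases minFrom_mem σ b with ⟨c, hc, h⟩ | h
  · exact h ▸ minFrom_le_apply σ (hab.trans hc)
  · rw [h]; exact minFrom_le σ a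

theorem card_apply_lt (σ : Equiv.Perm (Fin n)) {m : ℕ} (hm : m ≤ n) :
    (Finset.univ.filter fun i : Fin n => (σ i : ℕ) < m).card = m := by
  rw [← Finset.card_image_of_injective _ (Fin.val_injective.comp σ.injective)]
  convert Finset.card_range m
  ext v
  simp only [Finset.mem_image, Finset.mem_filter, Finset.mem_univ, true_and, Finset.mem_range,
    Function.comp]
  constructor
  · rintro ⟨i, hi, rfl⟩; exact hi
  · intro hv
    exact ⟨σ.symm ⟨v, hv.trans_le hm⟩, by simpa using hv, by simp⟩

theorem card_val_lt {m : ℕ} (hm : m ≤ n) :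
    (Finset.univ.filter fun i : Fin n => (i : ℕ) < m).card = m :=
  card_apply_lt (Equiv.refl _) hm

theorem filter_apply_lt_minFrom_subset (σ : Equiv.Perm (Fin n)) (k : ℕ) :
    (Finset.univ.filter fun i : Fin n => (σ i : ℕ) < minFrom σ k) ⊆
      Finset.univ.filter fun i : Fin n => (i : ℕ) < k := by
  intro i
  simp only [Finset.mem_filter, Finset.mem_univ, true_and]
  intro h
  by_contra hk
  exact absurd (minFrom_le_apply σ (not_lt.1 hk)) (not_le.2 h)

theorem minFrom_le_self (σ : Equiv.Perm (Fin n)) {k : ℕ} (hk : k ≤ n) : minFrom σ k ≤ k := by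
  have := Finset.card_le_card (filter_apply_lt_minFrom_subset σ k)
  rwa [card_apply_lt σ (minFrom_le σ k), card_val_lt hk] at this

theorem card_minFrom_lt_apply (σ : Equiv.Perm (Fin n)) {k : ℕ} (hk : k < n) :
    (Finset.univ.filter fun i : Fin n => (i : ℕ) < k ∧ minFrom σ k < σ i).card =
      k - minFrom σ k := by
  have h := Finset.card_sdiff_of_subset (filter_apply_lt_minFrom_subset σ k)
  rw [card_apply_lt σ (minFrom_le σ k), card_val_lt hk.le] at h
  rw [← h]
  congr 1
  ext i
  simp only [Finset.mem_sdiff, Finset.mem_filter, Finset.mem_univ, true_and, not_lt]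
  refine and_congr_right fun hi => ⟨le_of_lt, fun hle => lt_of_le_of_ne hle fun he => ?_⟩
  obtain ⟨c, hc, hce⟩ := exists_apply_eq_minFrom σ hk
  have : i = c := σ.injective (Fin.ext (by omega))
  subst this
  omega

/-- The number of inversions of a `231`-avoiding permutation is an area. -/
theorem Avoids231.invCount_eq {σ : Equiv.Perm (Fin n)} (hσ : Avoids231 σ) :
    invCount σ = ∑ k ∈ Finset.range n, (k - minFrom σ k) := by
  rw [← Fin.sum_univ_eq_sum_range (fun k => k - minFrom σ k)]
  have h1 : invCount σ = ∑ k : Fin n,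
      (Finset.univ.filter fun i : Fin n => (i : ℕ) < k ∧ minFrom σ k < σ i).card := by
    rw [invCount, Finset.card_eq_sum_card_fiberwise (f := Prod.snd) (t := Finset.univ)
      (fun _ _ => Finset.mem_coe.2 (Finset.mem_univ _))]
    refine Finset.sum_congr rfl fun k _ => ?_
    refine Finset.card_bij' (fun p _ => p.1) (fun i _ => (i, k)) ?_ ?_ ?_ ?_
    · rintro ⟨i, j⟩ h
      simp only [Finset.mem_filter, Finset.mem_univ, true_and] at h ⊢
      obtain ⟨⟨h1, h2⟩, rfl⟩ := h
      exact ⟨h1, (minFrom_le_apply σ le_rfl).trans_lt h2⟩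
    · intro i h
      simp only [Finset.mem_filter, Finset.mem_univ, true_and] at h ⊢
      obtain ⟨hik, h2⟩ := h
      refine ⟨⟨hik, ?_⟩, trivial⟩
      by_contra hlt
      obtain ⟨c, hc, hce⟩ := exists_apply_eq_minFrom σ k.isLt
      rw [← hce] at h2
      have hne : σ i ≠ σ k := fun h => (Fin.lt_def.2 hik).ne (σ.injective h)
      have hik' : σ i < σ k := lt_of_le_of_ne (not_lt.1 hlt) hne
      refine hσ ⟨i, k, c, hik, lt_of_le_of_ne hc ?_, h2, hik'⟩
      rintro rfl
      exact hlt h2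
    · rintro ⟨i, j⟩ h
      simp only [Finset.mem_filter, Finset.mem_univ, true_and] at h ⊢
      rw [h.2]
    · intro i h
      rfl
  rw [h1]
  exact Finset.sum_congr rfl fun k _ => card_minFrom_lt_apply σ k.isLt

/-- A `231`-avoiding permutation is determined by its right-to-left minima curve. -/
theorem Avoids231.eq_of_minFrom_eq {σ τ : Equiv.Perm (Fin n)} (hσ : Avoids231 σ)
    (hτ : Avoids231 τ) (h : ∀ k < n, minFrom σ k = minFrom τ k) : σ = τ := by
  have key : ∀ σ τ : Equiv.Perm (Fin n), Avoids231 τ → (∀ k < n, minFrom σ k = minFrom τ k) →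
      ∀ k : Fin n, (∀ c, k < c → σ c = τ c) → ¬ σ k < τ k := by
    intro σ τ hτ h k hk hlt
    have hik : τ.symm (σ k) < k := by
      rcases lt_trichotomy (τ.symm (σ k)) k with h1 | h1 | h1
      · exact h1
      · rw [Equiv.symm_apply_eq] at h1
        exact absurd h1 hlt.ne
      · have h2 := hk _ h1
        rw [Equiv.apply_symm_apply] at h2
        exact absurd (σ.injective h2) h1.ne'
    obtain ⟨c, hc, hce⟩ := exists_apply_eq_minFrom τ k.isLt
    have hle : τ c ≤ σ k := by
      rw [Fin.le_def, hce, ← h k k.isLt]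
      exact minFrom_le_apply σ le_rfl
    have hck : k < c := lt_of_le_of_ne hc (by rintro rfl; exact absurd hle (not_le.2 hlt))
    have hne : τ c ≠ σ k := fun he => by
      rw [← he, Equiv.symm_apply_apply] at hik
      exact absurd hik hck.le.not_gt
    exact hτ ⟨τ.symm (σ k), k, c, hik, hck, by simpa using lt_of_le_of_ne hle hne, by simpa using hlt⟩
  have main : ∀ m : ℕ, ∀ k : Fin n, n - (k : ℕ) ≤ m → σ k = τ k := by
    intro m
    induction m with
    | zero => intro k hk; have := k.isLt; omega
    | succ m ih =>
      intro k hk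
      have hlater : ∀ c, k < c → σ c = τ c := fun c hc => ih c (by
        have := Fin.lt_def.1 hc; have := c.isLt; omega)
      exact le_antisymm
        (not_lt.1 (key τ σ hσ (fun k hk => (h k hk).symm) k fun c hc => (hlater c hc).symm))
        (not_lt.1 (key σ τ hτ h k hlater))
  exact Equiv.ext fun k => main _ k le_rfl

/-- The sequence choosing at step `r` the least unused value which is at least `G r`. -/
def greedy (G : ℕ → ℕ) (r : ℕ) : ℕ :=
  Nat.strongRec (fun r f => sInf {v : ℕ | G r ≤ v ∧ ∀ (s : ℕ) (hs : s < r), f s hs ≠ v}) r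

theorem greedy_eq (G : ℕ → ℕ) (r : ℕ) :
    greedy G r = sInf {v : ℕ | G r ≤ v ∧ ∀ s < r, greedy G s ≠ v} := by
  rw [greedy, Nat.strongRec_eq]
  rfl

theorem greedy_le {G : ℕ → ℕ} {r v : ℕ} (h : G r ≤ v) (h' : ∀ s < r, greedy G s ≠ v) :
    greedy G r ≤ v := by
  rw [greedy_eq]
  exact Nat.sInf_le ⟨h, h'⟩

theorem exists_unused {G : ℕ → ℕ} {r : ℕ} (h : G r + r < n) :
    ∃ v < n, G r ≤ v ∧ ∀ s < r, greedy G s ≠ v := by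
  have hc : 0 < (Finset.Ico (G r) n \ (Finset.range r).image (greedy G)).card := by
    have h1 := Finset.le_card_sdiff ((Finset.range r).image (greedy G)) (Finset.Ico (G r) n)
    have h2 := Finset.card_image_le (s := Finset.range r) (f := greedy G)
    rw [Finset.card_range] at h2
    rw [Nat.card_Ico] at h1
    omega
  obtain ⟨v, hv⟩ := Finset.card_pos.1 hc
  simp only [Finset.mem_sdiff, Finset.mem_Ico, Finset.mem_image, Finset.mem_range, not_exists,
    not_and] at hv
  exact ⟨v, hv.1.2, hv.1.1, hv.2⟩

theorem greedy_spec {G : ℕ → ℕ} {r : ℕ} (h : G r + r < n) :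
    greedy G r < n ∧ G r ≤ greedy G r ∧ ∀ s < r, greedy G s ≠ greedy G r := by
  obtain ⟨v, hv, hv'⟩ := exists_unused h
  refine ⟨(greedy_le hv'.1 hv'.2).trans_lt hv, ?_⟩
  have := Nat.sInf_mem (s := {v : ℕ | G r ≤ v ∧ ∀ s < r, greedy G s ≠ v}) ⟨v, hv'⟩
  rwa [← greedy_eq] at this

theorem exists_avoids231_minFrom_eq (F : ℕ → ℕ) (hmono : ∀ a b, a ≤ b → b < n → F a ≤ F b)
    (hle : ∀ k < n, F k ≤ k) :
    ∃ σ : Equiv.Perm (Fin n), Avoids231 σ ∧ ∀ k < n, minFrom σ k = F k := by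
  set G : ℕ → ℕ := fun r => F (n - 1 - r)
  have hG : ∀ r < n, G r + r < n := fun r hr => by
    have := hle (n - 1 - r) (by omega)
    simp only [G]; omega
  have hrev : ∀ k : Fin n, n - 1 - (k : ℕ) < n := fun k => by have := k.isLt; omega
  let f : Fin n → Fin n := fun k => ⟨greedy G (n - 1 - k), (greedy_spec (hG _ (hrev k))).1⟩
  have hne : ∀ i j : Fin n, i < j → f i ≠ f j := fun i j hij h => by
    have h1 := (greedy_spec (hG _ (hrev i))).2.2 (n - 1 - j) (by
      have := Fin.lt_def.1 hij; have := j.isLt; omega)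
    exact h1 (Fin.ext_iff.1 h).symm
  have hinj : Function.Injective f := fun i j h => by
    rcases lt_trichotomy i j with h1 | h1 | h1
    · exact absurd h (hne i j h1)
    · exact h1
    · exact absurd h.symm (hne j i h1)
  have hGF : ∀ k : Fin n, G (n - 1 - k) = F k := fun k => by
    simp only [G]; congr 1; have := k.isLt; omega
  have hFf : ∀ k : Fin n, F k ≤ f k := fun k => hGF k ▸ (greedy_spec (hG _ (hrev k))).2.1
  have hfle : ∀ (k : Fin n) (v : ℕ), F k ≤ v → (∀ c, k < c → (f c : ℕ) ≠ v) → (f k : ℕ) ≤ v := by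
    intro k v hv hc
    refine greedy_le (by rw [hGF]; exact hv) fun s hs => ?_
    have := hc ⟨n - 1 - s, by omega⟩ (Fin.lt_def.2 (by simp only; omega))
    simp only [f] at this
    rwa [show n - 1 - (n - 1 - s) = s by omega] at this
  refine ⟨Equiv.ofBijective f (Finite.injective_iff_bijective.1 hinj), ?_, ?_⟩
  · rintro ⟨i, j, k, hij, hjk, h1, h2⟩
    simp only [Equiv.ofBijective_apply] at h1 h2
    refine absurd (hfle j (f i) ?_ ?_) (not_le.2 h2)
    · exact (hmono _ _ (Fin.lt_def.1 hjk).le k.isLt).trans ((hFf k).trans (Fin.lt_def.1 h1).le)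
    · intro c hc h
      exact absurd (hinj (Fin.ext h)) (hij.trans hc).ne'
  · intro k hk
    refine le_antisymm ?_ ?_
    · by_contra hlt
      have hno : ∀ c : Fin n, k ≤ c → (f c : ℕ) ≠ F k := fun c hc h => hlt (by
        have := minFrom_le_apply (Equiv.ofBijective f (Finite.injective_iff_bijective.1 hinj)) hc
        rwa [Equiv.ofBijective_apply, h] at this)
      have := hfle ⟨k, hk⟩ (F k) le_rfl fun c hc => hno c (Fin.lt_def.1 hc).le
      exact hno ⟨k, hk⟩ le_rfl (le_antisymm this (hFf ⟨k, hk⟩))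
    · obtain ⟨c, hc, h⟩ := exists_apply_eq_minFrom
        (Equiv.ofBijective f (Finite.injective_iff_bijective.1 hinj)) hk
      rw [← h, Equiv.ofBijective_apply]
      exact (hmono _ _ hc c.isLt).trans (hFf c)

end MinFrom

section Paths

/-- The number of up-steps before time `j` of the path with set of up-steps `U`. -/
def upCount (U : Finset ℕ) (j : ℕ) : ℕ := (U.filter (· < j)).card

theorem upCount_zero (U : Finset ℕ) : upCount U 0 = 0 := by simp [upCount]

theorem upCount_mono (U : Finset ℕ) : Monotone (upCount U) := fun a b hab =>
  Finset.card_le_card fun x => by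
    simp only [Finset.mem_filter]
    exact fun h => ⟨h.1, h.2.trans_le hab⟩

theorem upCount_succ (U : Finset ℕ) (j : ℕ) :
    upCount U (j + 1) = upCount U j + if j ∈ U then 1 else 0 := by
  have h : (U.filter (· < j + 1)) = U.filter (· < j) ∪ U.filter (· = j) := by
    ext x
    simp only [Finset.mem_filter, Finset.mem_union, ← and_or_left]
    exact and_congr_right fun _ => by omega
  have hd : Disjoint (U.filter (· < j)) (U.filter (· = j)) := by
    rw [Finset.disjoint_filter]
    intro x _ h1 h2
    omega
  rw [upCount, h, Finset.card_union_of_disjoint hd, upCount, Finset.filter_eq']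
  split_ifs <;> simp

theorem upCount_le (U : Finset ℕ) (j : ℕ) : upCount U j ≤ j := by
  induction j with
  | zero => simp [upCount_zero]
  | succ j ih => rw [upCount_succ]; split_ifs <;> omega

theorem upCount_of_subset {U : Finset ℕ} {N : ℕ} (h : U ⊆ Finset.range N) :
    upCount U N = U.card := by
  rw [upCount, Finset.filter_true_of_mem]
  exact fun x hx => Finset.mem_range.1 (h hx)

/-- The height at time `j` of the path with set of up-steps `U`. -/
def pathHeight (U : Finset ℕ) (j : ℕ) : ℝ := 2 * upCount U j - j

/-- The `±1` step at time `j` of the path with set of up-steps `U`. -/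
def pathStep (U : Finset ℕ) (j : ℕ) : ℝ := if j ∈ U then 1 else -1

theorem pathHeight_zero (U : Finset ℕ) : pathHeight U 0 = 0 := by simp [pathHeight, upCount_zero]

theorem pathHeight_succ (U : Finset ℕ) (j : ℕ) :
    pathHeight U (j + 1) = pathHeight U j + pathStep U j := by
  simp only [pathHeight, pathStep, upCount_succ]
  split_ifs <;> push_cast <;> ring

theorem pathHeight_sub_eq_sum (U : Finset ℕ) (a L : ℕ) :
    pathHeight U (a + L) - pathHeight U a = ∑ r ∈ Finset.range L, pathStep U (a + r) := by
  induction L with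
  | zero => simp
  | succ L ih => rw [Finset.sum_range_succ, ← ih, ← add_assoc, pathHeight_succ]; ring

theorem pathHeight_sq (U : Finset ℕ) (N : ℕ) :
    pathHeight U N ^ 2 = ∑ j ∈ Finset.range N, (2 * pathStep U j * pathHeight U j + 1) := by
  induction N with
  | zero => simp [pathHeight_zero]
  | succ N ih =>
    rw [Finset.sum_range_succ, ← ih, pathHeight_succ]
    have : pathStep U N ^ 2 = 1 := by simp only [pathStep]; split_ifs <;> norm_num
    linear_combination this

theorem sum_pathHeight_eq {U : Finset ℕ} {n : ℕ} (hU : U ⊆ Finset.range (2 * n))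
    (h : pathHeight U (2 * n) = 0) :
    ∑ j ∈ Finset.range (2 * n), pathHeight U j = 2 * (∑ j ∈ U, pathHeight U j) + n := by
  have h1 := pathHeight_sq U (2 * n)
  rw [h, Finset.sum_add_distrib] at h1
  simp only [Finset.sum_const, Finset.card_range, nsmul_eq_mul] at h1
  have h2 : 2 * ∑ j ∈ U, pathHeight U j =
      ∑ j ∈ Finset.range (2 * n), (1 + pathStep U j) * pathHeight U j := by
    have hUf : (Finset.range (2 * n)).filter (· ∈ U) = U := by
      rw [Finset.filter_mem_eq_inter, Finset.inter_eq_right.2 hU]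
    have hs : ∑ j ∈ U, pathHeight U j =
        ∑ j ∈ Finset.range (2 * n), if j ∈ U then pathHeight U j else 0 := by
      rw [← Finset.sum_filter, hUf]
    rw [hs, Finset.mul_sum]
    refine Finset.sum_congr rfl fun j _ => ?_
    simp only [pathStep]
    split_ifs <;> ring
  have h3 : ∑ j ∈ Finset.range (2 * n), 2 * pathStep U j * pathHeight U j =
      2 * ∑ j ∈ Finset.range (2 * n), pathStep U j * pathHeight U j := by
    rw [Finset.mul_sum]; exact Finset.sum_congr rfl fun j _ => by ring
  simp only [add_mul, one_mul, Finset.sum_add_distrib] at h2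
  rw [h3] at h1
  push_cast at h1
  linarith

variable {n : ℕ}

/-- The set of up-steps of the Dyck path associated with `σ`. -/
def upSet (σ : Equiv.Perm (Fin n)) : Finset ℕ :=
  (Finset.range n).image fun k => k + minFrom σ k

theorem strictMono_add_minFrom (σ : Equiv.Perm (Fin n)) :
    StrictMono fun k => k + minFrom σ k :=
  strictMono_id.add_monotone (minFrom_mono σ)

theorem upSet_subset (σ : Equiv.Perm (Fin n)) : upSet σ ⊆ Finset.range (2 * n) := by
  intro x hx
  obtain ⟨k, hk, rfl⟩ := Finset.mem_image.1 hx
  have := Finset.mem_range.1 hk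
  have := minFrom_lt σ this
  exact Finset.mem_range.2 (by omega)

theorem card_upSet (σ : Equiv.Perm (Fin n)) : (upSet σ).card = n := by
  rw [upSet, Finset.card_image_of_injective _ (strictMono_add_minFrom σ).injective,
    Finset.card_range]

theorem upCount_upSet (σ : Equiv.Perm (Fin n)) {k : ℕ} (hk : k ≤ n) :
    upCount (upSet σ) (k + minFrom σ k) = k := by
  have h : (upSet σ).filter (· < k + minFrom σ k) =
      (Finset.range k).image fun i => i + minFrom σ i := by
    ext x
    simp only [upSet, Finset.mem_filter, Finset.mem_image, Finset.mem_range]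
    constructor
    · rintro ⟨⟨i, hi, rfl⟩, h⟩
      exact ⟨i, (strictMono_add_minFrom σ).lt_iff_lt.1 h, rfl⟩
    · rintro ⟨i, hi, rfl⟩
      exact ⟨⟨i, hi.trans_le hk, rfl⟩, strictMono_add_minFrom σ hi⟩
  rw [upCount, h, Finset.card_image_of_injective _ (strictMono_add_minFrom σ).injective,
    Finset.card_range]

theorem pathHeight_upSet_end (σ : Equiv.Perm (Fin n)) : pathHeight (upSet σ) (2 * n) = 0 := by
  rw [pathHeight, upCount_of_subset (upSet_subset σ), card_upSet]
  push_cast; ring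

theorem Avoids231.sum_pathHeight {σ : Equiv.Perm (Fin n)} (hσ : Avoids231 σ) :
    ∑ j ∈ Finset.range (2 * n), pathHeight (upSet σ) j = 2 * invCount σ + n := by
  rw [sum_pathHeight_eq (upSet_subset σ) (pathHeight_upSet_end σ), hσ.invCount_eq]
  congr 2
  rw [Nat.cast_sum]
  conv_lhs => rw [upSet]
  rw [Finset.sum_image fun a _ b _ h => (strictMono_add_minFrom σ).injective h]
  refine Finset.sum_congr rfl fun k hk => ?_
  have hk := Finset.mem_range.1 hk
  change pathHeight (upSet σ) (k + minFrom σ k) = _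
  rw [pathHeight, upCount_upSet σ hk.le, Nat.cast_sub (minFrom_le_self σ hk.le)]
  push_cast; ring

theorem Avoids231.eq_of_upSet_eq {σ τ : Equiv.Perm (Fin n)} (hσ : Avoids231 σ)
    (hτ : Avoids231 τ) (h : upSet σ = upSet τ) : σ = τ := by
  refine hσ.eq_of_minFrom_eq hτ fun k hk => ?_
  have hmem : k + minFrom σ k ∈ upSet σ := Finset.mem_image.2 ⟨k, Finset.mem_range.2 hk, rfl⟩
  rw [h] at hmem
  obtain ⟨i, hi, hie⟩ := Finset.mem_image.1 hmem
  have h1 := upCount_upSet τ (Finset.mem_range.1 hi).le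
  rw [hie, ← h, upCount_upSet σ hk.le] at h1
  subst h1
  omega

theorem exists_avoids231_upSet_eq {U : Finset ℕ} (hU : U ⊆ Finset.range (2 * n))
    (hcard : U.card = n) (hpos : ∀ j ≤ 2 * n, j ≤ 2 * upCount U j) :
    ∃ σ : Equiv.Perm (Fin n), Avoids231 σ ∧ upSet σ = U := by
  let e := U.orderEmbOfFin hcard
  have he : ∀ k, upCount U (e k) = k := fun k => by
    have : U.filter (· < e k) = (Finset.univ.filter fun i : Fin n => (i : ℕ) < k).image e := by
      ext x
      simp only [Finset.mem_filter, Finset.mem_image, Finset.mem_univ, true_and]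
      constructor
      · rintro ⟨hx, hxk⟩
        have : x ∈ Set.range e := by rw [Finset.range_orderEmbOfFin]; exact hx
        obtain ⟨i, rfl⟩ := this
        exact ⟨i, e.lt_iff_lt.1 hxk, rfl⟩
      · rintro ⟨i, hi, rfl⟩
        exact ⟨Finset.orderEmbOfFin_mem U hcard i, e.lt_iff_lt.2 hi⟩
    rw [upCount, this, Finset.card_image_of_injective _ e.injective, card_val_lt k.isLt.le]
  let F : ℕ → ℕ := fun k => if h : k < n then e ⟨k, h⟩ - k else 0
  have hle : ∀ k : Fin n, (k : ℕ) ≤ e k := fun k => by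
    have := upCount_le U (e k); rwa [he] at this
  have hmono : ∀ a b, a ≤ b → b < n → F a ≤ F b := by
    intro a b hab hb
    simp only [F, dif_pos hb, dif_pos (hab.trans_lt hb)]
    have key : ∀ m (hm : a + m < n), e ⟨a, by omega⟩ + m ≤ e ⟨a + m, hm⟩ := by
      intro m
      induction m with
      | zero => intro hm; simp
      | succ m ih =>
        intro hm
        have h1 := ih (by omega)
        have h2 : e ⟨a + m, by omega⟩ < e ⟨a + (m + 1), hm⟩ :=
          e.lt_iff_lt.2 (Fin.lt_def.2 (by simp only; omega))
        omega
    obtain ⟨m, rfl⟩ := Nat.exists_eq_add_of_le hab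
    have := key m hb
    omega
  have hle' : ∀ k < n, F k ≤ k := by
    intro k hk
    simp only [F, dif_pos hk]
    have h1 := he ⟨k, hk⟩
    have h2 : e ⟨k, hk⟩ < 2 * n := Finset.mem_range.1 (hU (Finset.orderEmbOfFin_mem U hcard _))
    have h3 := hpos _ h2.le
    simp only at h1
    omega
  obtain ⟨σ, hσ, hF⟩ := exists_avoids231_minFrom_eq F hmono hle'
  refine ⟨σ, hσ, ?_⟩
  ext x
  simp only [upSet, Finset.mem_image, Finset.mem_range]
  have hval : ∀ k (hk : k < n), k + minFrom σ k = e ⟨k, hk⟩ := fun k hk => by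
    have := hle ⟨k, hk⟩
    rw [hF k hk]
    simp only [F, dif_pos hk]
    simp only at this
    omega
  constructor
  · rintro ⟨k, hk, rfl⟩
    rw [hval k hk]
    exact Finset.orderEmbOfFin_mem U hcard _
  · intro hx
    have : x ∈ Set.range e := by rw [Finset.range_orderEmbOfFin]; exact hx
    obtain ⟨i, rfl⟩ := this
    exact ⟨i, i.isLt, hval i i.isLt⟩

theorem discF_eq (σ : Equiv.Perm (Fin n)) (u : ℝ) : discF σ u = minFrom σ ⌊u⌋₊ := by
  have hiff : ∀ c : Fin n, u < ((c : ℕ) : ℝ) + 1 ↔ ⌊u⌋₊ ≤ c := fun c => by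
    rw [← Nat.lt_succ_iff, Nat.floor_lt' (Nat.succ_ne_zero _)]
    push_cast; rfl
  rw [discF]
  split_ifs with h
  · rcases Nat.eq_zero_or_pos n with rfl | hn
    · have : {v : ℝ | ∃ c : Fin 0, u < (c : ℕ) + 1 ∧ v = (((σ c : Fin 0) : ℕ) : ℝ)} = ∅ := by
        ext v; simp
      rw [this, Real.sInf_empty]
      have := minFrom_le σ ⌊u⌋₊
      simp [Nat.le_zero.1 this]
    · have hfl : ⌊u⌋₊ < n := by rwa [Nat.floor_lt' hn.ne']
      obtain ⟨c, hc, hce⟩ := exists_apply_eq_minFrom σ hfl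
      refine IsLeast.csInf_eq ⟨⟨c, (hiff c).2 hc, by rw [hce]⟩, ?_⟩
      rintro _ ⟨d, hd, rfl⟩
      exact_mod_cast minFrom_le_apply σ ((hiff d).1 hd)
  · rw [minFrom_of_le σ (Nat.le_floor (not_lt.1 h))]

theorem fcurve_eq (σ : Equiv.Perm (Fin n)) (x : ℝ) : fcurve σ x = minFrom σ ⌊n * x⌋₊ / n := by
  rw [fcurve, discF_eq]

theorem monotone_fcurve (σ : Equiv.Perm (Fin n)) : Monotone (fcurve σ) := by
  intro x y hxy
  rw [fcurve_eq, fcurve_eq]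
  have : minFrom σ ⌊n * x⌋₊ ≤ minFrom σ ⌊n * y⌋₊ :=
    minFrom_mono σ (Nat.floor_mono (mul_le_mul_of_nonneg_left hxy n.cast_nonneg))
  gcongr

theorem mem_completedGraph_fcurve (hn : 1 ≤ n) (σ : Equiv.Perm (Fin n)) {j : ℕ}
    (hj : j ≤ 2 * n) :
    ((upCount (upSet σ) j / n : ℝ), ((j : ℝ) - upCount (upSet σ) j) / n) ∈
      completedGraph (fcurve σ) := by
  have hn0 : (0 : ℝ) < n := by exact_mod_cast hn
  set c := upCount (upSet σ) j with hc
  have hcn : c ≤ n := by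
    rw [← card_upSet σ]
    exact Finset.card_le_card (Finset.filter_subset _ _)
  have hupper : j ≤ c + minFrom σ c := by
    by_contra hlt
    have hc_lt : c < n := by
      refine lt_of_le_of_ne hcn fun h => hlt ?_
      rw [minFrom_of_le σ h.ge]; omega
    have h1 := upCount_mono (upSet σ) (not_le.1 hlt : c + minFrom σ c + 1 ≤ j)
    have hmem : c + minFrom σ c ∈ upSet σ :=
      Finset.mem_image.2 ⟨c, Finset.mem_range.2 hc_lt, rfl⟩
    rw [upCount_succ, if_pos hmem, upCount_upSet σ hcn] at h1
    omega
  have hlower : ∀ i < c, i + minFrom σ i < j := by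
    intro i hi
    by_contra hlt
    have h1 := upCount_mono (upSet σ) (not_lt.1 hlt)
    rw [upCount_upSet σ (by omega)] at h1
    omega
  have hle : c ≤ j := upCount_le _ _
  refine ⟨⟨by positivity, ?_⟩, ?_, ?_⟩
  · simp only
    rw [div_le_one hn0]
    exact_mod_cast hcn
  · simp only
    refine le_of_tendsto ((monotone_fcurve σ).tendsto_leftLim _) ?_
    filter_upwards [self_mem_nhdsWithin] with y hy
    rw [fcurve_eq]
    have hy : y * n < c := (lt_div_iff₀ hn0).1 hy
    have hfl : ⌊(n : ℝ) * y⌋₊ + 1 ≤ c ∨ ⌊(n : ℝ) * y⌋₊ = 0 := by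
      rcases Nat.eq_zero_or_pos c with h0 | h0
      · right
        rw [h0] at hy
        refine Nat.floor_of_nonpos ?_
        push_cast at hy
        linarith
      · left
        rw [Nat.succ_le_iff, Nat.floor_lt' h0.ne']
        linarith
    have : minFrom σ ⌊(n : ℝ) * y⌋₊ ≤ j - c := by
      rcases hfl with h | h
      · have h1 := hlower (c - 1) (by omega)
        have h2 := minFrom_mono σ (by omega : ⌊(n : ℝ) * y⌋₊ ≤ c - 1)
        omega
      · rw [h]
        exact (minFrom_le_self σ (Nat.zero_le n)).trans (Nat.zero_le _)
    gcongr
    rw [← Nat.cast_sub hle]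
    exact_mod_cast this
  · simp only
    rw [fcurve_eq, mul_div_cancel₀ _ hn0.ne', Nat.floor_natCast]
    gcongr
    rw [← Nat.cast_sub hle]
    exact_mod_cast (by omega : j - c ≤ minFrom σ c)

/-- The excursion of `σ` interpolates the rescaled Dyck path of `σ`. -/
theorem apply_eq_pathHeight (hn : 1 ≤ n) {σ : Equiv.Perm (Fin n)} {φ : ℝ → ℝ}
    (h : completedGraph (fcurve σ) = excursionGraph φ) {j : ℕ} (hj : j ≤ 2 * n) :
    φ (j / (2 * n)) = pathHeight (upSet σ) j / (2 * n) := by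
  have hn0 : (0 : ℝ) < n := by exact_mod_cast hn
  have hmem := mem_completedGraph_fcurve hn σ hj
  rw [h] at hmem
  obtain ⟨t, -, ht⟩ := hmem
  obtain ⟨h1, h2⟩ := Prod.ext_iff.1 ht
  simp only at h1 h2
  have e1 : t = j / (2 * n) := by
    have : 2 * t = j / n := by
      have := congrArg₂ (· + ·) h1 h2
      rw [← add_div] at this
      linarith [show ((upCount (upSet σ) j : ℝ) + (j - upCount (upSet σ) j)) / n = j / n by ring]
    rw [eq_div_iff (by positivity)]
    field_simp at this
    linarith
  rw [← e1, pathHeight]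
  have : 2 * φ t = (2 * upCount (upSet σ) j - j) / n := by
    rw [show (2 * (upCount (upSet σ) j : ℝ) - j) / n =
      upCount (upSet σ) j / n - (j - upCount (upSet σ) j) / n by ring]
    linarith
  rw [eq_div_iff (by positivity)]
  field_simp at this
  linarith

end Paths

section Area

theorem abs_integral_sub_riemannSum_le {φ : ℝ → ℝ} (hφ : LipschitzWith 1 φ) {N : ℕ}
    (hN : 0 < N) :
    |(∫ t in (0 : ℝ)..1, φ t) - (∑ j ∈ Finset.range N, φ (j / N)) / N| ≤ 1 / N := by
  have hN0 : (0 : ℝ) < N := by exact_mod_cast hN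
  have hint : ∀ a b, IntervalIntegrable φ volume a b := fun a b =>
    hφ.continuous.intervalIntegrable a b
  have hsum := intervalIntegral.sum_integral_adjacent_intervals (μ := volume) (f := φ)
    (a := fun j : ℕ => (j : ℝ) / N) (n := N) fun _ _ => hint _ _
  simp only [Nat.cast_zero, zero_div, div_self hN0.ne'] at hsum
  rw [← hsum, Finset.sum_div, ← Finset.sum_sub_distrib]
  refine (Finset.abs_sum_le_sum_abs _ _).trans ?_
  have hlen : ∀ j : ℕ, ((j + 1 : ℕ) : ℝ) / N - j / N = 1 / N := fun j => by push_cast; ring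
  have hle : ∀ j ∈ Finset.range N,
      |(∫ t in (j : ℝ) / N..((j + 1 : ℕ) : ℝ) / N, φ t) - φ (j / N) / N| ≤ 1 / N * (1 / N) := by
    intro j _
    have hc : φ (j / N) / N = ∫ _ in (j : ℝ) / N..((j + 1 : ℕ) : ℝ) / N, φ (j / N) := by
      rw [intervalIntegral.integral_const, hlen, smul_eq_mul]; ring
    rw [hc, ← intervalIntegral.integral_sub (hint _ _) (by simp), ← Real.norm_eq_abs]
    have hlt : (j : ℝ) / N ≤ ((j + 1 : ℕ) : ℝ) / N := by
      have := hlen j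
      have : (0 : ℝ) < 1 / N := by positivity
      linarith
    refine (intervalIntegral.norm_integral_le_of_norm_le_const (C := 1 / N) fun t ht => ?_).trans
      (by rw [hlen, abs_of_pos (by positivity)])
    rw [uIoc_of_le hlt] at ht
    have h1 := hφ.dist_le_mul t (j / N)
    rw [Real.dist_eq, Real.dist_eq, NNReal.coe_one, one_mul,
      abs_of_pos (sub_pos.2 ht.1)] at h1
    rw [Real.norm_eq_abs]
    linarith [ht.2, hlen j]
  refine (Finset.sum_le_sum hle).trans (le_of_eq ?_)
  rw [Finset.sum_const, Finset.card_range, nsmul_eq_mul]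
  field_simp

theorem Espace.abs_integral_sub_le {φ ψ : Espace} {δ : ℝ} (h : dist ψ.1 φ.1 ≤ δ) :
    |(∫ t in (0 : ℝ)..1, ψ.1 t) - ∫ t in (0 : ℝ)..1, φ.1 t| ≤ δ := by
  rw [← intervalIntegral.integral_sub (ψ.1.continuous.intervalIntegrable _ _)
    (φ.1.continuous.intervalIntegrable _ _), ← Real.norm_eq_abs]
  refine (intervalIntegral.norm_integral_le_of_norm_le_const (C := δ) fun t _ => ?_).trans
    (by simp)
  rw [← dist_eq_norm]
  exact (BoundedContinuousFunction.dist_coe_le_dist t).trans h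

variable {n : ℕ}

theorem Avoids231.abs_invCount_sub_le (hn : 1 ≤ n) {σ : Equiv.Perm (Fin n)} (hσ : Avoids231 σ)
    {ψ : Espace} (h : completedGraph (fcurve σ) = excursionGraph ⇑ψ.1) :
    |(invCount σ : ℝ) - 2 * n ^ 2 * ∫ t in (0 : ℝ)..1, ψ.1 t| ≤ 2 * (n : ℝ) := by
  have hn0 : (0 : ℝ) < n := by exact_mod_cast hn
  have h1 := abs_integral_sub_riemannSum_le ψ.lipschitz (N := 2 * n) (by omega)
  have h2 : ∑ j ∈ Finset.range (2 * n), ψ.1 (j / (2 * n : ℕ)) =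
      (2 * invCount σ + n) / (2 * n) := by
    rw [← hσ.sum_pathHeight, Finset.sum_div]
    refine Finset.sum_congr rfl fun j hj => ?_
    rw [← apply_eq_pathHeight hn h (Finset.mem_range.1 hj).le]
    push_cast; rfl
  rw [h2] at h1
  push_cast at h1
  set I := ∫ t in (0 : ℝ)..1, ψ.1 t
  have h3 : I - (2 * invCount σ + n) / (2 * n) / (2 * n) =
      -((invCount σ - 2 * n ^ 2 * I) + n / 2) / (2 * n ^ 2) := by field_simp; ring
  rw [h3, abs_div, abs_neg, abs_of_pos (by positivity : (0 : ℝ) < 2 * n ^ 2),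
    div_le_div_iff₀ (by positivity) (by positivity)] at h1
  have h4 : |((invCount σ : ℝ) - 2 * n ^ 2 * I) + n / 2| ≤ (n : ℝ) := by
    have : |((invCount σ : ℝ) - 2 * n ^ 2 * I) + n / 2| * (2 * n) ≤ (n : ℝ) * (2 * n) := by
      refine h1.trans (le_of_eq ?_); ring
    exact le_of_mul_le_mul_right this (by positivity)
  rw [abs_le] at h4 ⊢
  constructor <;> linarith

theorem Avoids231.abs_tilt_sub_le (β : ℝ) (hn : 1 ≤ n) {σ : Equiv.Perm (Fin n)}
    (hσ : Avoids231 σ) {φ ψ : Espace} (h : completedGraph (fcurve σ) = excursionGraph ⇑ψ.1)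
    {δ : ℝ} (hδ : dist ψ.1 φ.1 ≤ δ) :
    |β / n * invCount σ - n * (2 * β * ∫ t in (0 : ℝ)..1, φ.1 t)| ≤ |β| * (2 * δ * n + 2) := by
  have hn0 : (0 : ℝ) < n := by exact_mod_cast hn
  have h1 := hσ.abs_invCount_sub_le hn h
  have h2 := Espace.abs_integral_sub_le hδ
  set I := ∫ t in (0 : ℝ)..1, ψ.1 t
  set I' := ∫ t in (0 : ℝ)..1, φ.1 t
  have h3 : β / n * invCount σ - n * (2 * β * I') =
      β * ((invCount σ - 2 * n ^ 2 * I) / n + 2 * n * (I - I')) := by field_simp; ring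
  rw [h3, abs_mul]
  refine mul_le_mul_of_nonneg_left ?_ (abs_nonneg _)
  refine (abs_add_le _ _).trans ?_
  rw [abs_div, abs_mul, abs_of_pos hn0, abs_of_pos (by positivity : (0 : ℝ) < 2 * n)]
  have h4 : |(invCount σ : ℝ) - 2 * n ^ 2 * I| / (n : ℝ) ≤ 2 := by rwa [div_le_iff₀ hn0]
  have h5 := mul_le_mul_of_nonneg_left h2 (by positivity : (0 : ℝ) ≤ 2 * n)
  linarith

end Area

section UpperBound

theorem card_mul_exp_le_prod_cosh {N : ℕ} {T : Finset (Finset ℕ)}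
    (hT : ∀ U ∈ T, U ⊆ Finset.range N) (lam : ℕ → ℝ) {c : ℝ}
    (hc : ∀ U ∈ T, c ≤ ∑ j ∈ Finset.range N, lam j * pathStep U j) :
    T.card * Real.exp c ≤ ∏ j ∈ Finset.range N, (2 * Real.cosh (lam j)) := by
  have hcosh : ∀ x : ℝ, 2 * Real.cosh x = Real.exp x + Real.exp (-x) := fun x => by
    rw [Real.cosh_eq]; ring
  simp only [hcosh]
  rw [Finset.prod_add, ← nsmul_eq_mul]
  refine (Finset.card_nsmul_le_sum T _ _ fun U hU => ?_).trans
    (Finset.sum_le_sum_of_subset_of_nonneg (fun U hU => Finset.mem_powerset.2 (hT U hU))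
      fun U _ _ => by positivity)
  refine (Real.exp_le_exp.2 (hc U hU)).trans (le_of_eq ?_)
  rw [Real.exp_sum, ← Finset.prod_sdiff (hT U hU), mul_comm]
  congr 1
  · exact Finset.prod_congr rfl fun j hj => by rw [pathStep, if_pos hj, mul_one]
  · refine Finset.prod_congr rfl fun j hj => ?_
    rw [pathStep, if_neg (Finset.mem_sdiff.1 hj).2, mul_neg, mul_one]

theorem prod_range_mul_eq {M : Type*} [CommMonoid M] (f : ℕ → M) (m L : ℕ) :
    ∏ j ∈ Finset.range (m * L), f j =
      ∏ i ∈ Finset.range m, ∏ r ∈ Finset.range L, f (i * L + r) := by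
  induction m with
  | zero => simp
  | succ m ih => rw [Nat.succ_mul, Finset.prod_range_add, ih, Finset.prod_range_succ]

theorem card_mul_exp_le_prod_cosh_pow {N m L : ℕ} (hmL : m * L ≤ N) {T : Finset (Finset ℕ)}
    (hT : ∀ U ∈ T, U ⊆ Finset.range N) (lam : ℕ → ℝ) {c : ℝ}
    (hc : ∀ U ∈ T, c ≤ ∑ i ∈ Finset.range m,
      lam i * (pathHeight U ((i + 1) * L) - pathHeight U (i * L))) :
    T.card * Real.exp c ≤ 2 ^ N * ∏ i ∈ Finset.range m, Real.cosh (lam i) ^ L := by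
  let lam' : ℕ → ℝ := fun j => if j < m * L then lam (j / L) else 0
  have h0 : ∀ r, lam' (m * L + r) = 0 := fun r => if_neg (by omega)
  have h1 : ∀ i < m, ∀ r < L, lam' (i * L + r) = lam i := fun i hi r hr => by
    have : i * L + r < m * L := by
      calc i * L + r < (i + 1) * L := by rw [Nat.succ_mul]; omega
        _ ≤ m * L := Nat.mul_le_mul_right _ hi
    simp only [lam', if_pos this]
    rw [mul_comm, Nat.mul_add_div (by omega), Nat.div_eq_of_lt hr, add_zero]
  obtain ⟨R, rfl⟩ := Nat.exists_eq_add_of_le hmL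
  refine (card_mul_exp_le_prod_cosh hT lam' fun U hU => (hc U hU).trans (le_of_eq ?_)).trans
    (le_of_eq ?_)
  · have hsum := congrArg Multiplicative.toAdd
      (prod_range_mul_eq (fun j => Multiplicative.ofAdd (lam' j * pathStep U j)) m L)
    simp only [toAdd_prod, toAdd_ofAdd] at hsum
    rw [Finset.sum_range_add, hsum]
    simp only [h0, zero_mul, Finset.sum_const_zero, add_zero]
    refine Finset.sum_congr rfl fun i hi => ?_
    rw [Nat.succ_mul, pathHeight_sub_eq_sum, Finset.mul_sum]
    exact Finset.sum_congr rfl fun r hr => by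
      rw [h1 i (Finset.mem_range.1 hi) r (Finset.mem_range.1 hr)]
  · rw [Finset.prod_mul_distrib, Finset.prod_const, Finset.card_range, Finset.prod_range_add,
      prod_range_mul_eq]
    simp only [h0, Real.cosh_zero, Finset.prod_const_one, mul_one]
    congr 1
    refine Finset.prod_congr rfl fun i hi => ?_
    rw [Finset.prod_congr rfl fun r hr => by
      rw [h1 i (Finset.mem_range.1 hi) r (Finset.mem_range.1 hr)], Finset.prod_const,
      Finset.card_range]

theorem card_le_exp_of_dist_le (φ : Espace) {m : ℕ} (hm : 0 < m) (lam : ℕ → ℝ) {n : ℕ}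
    (hn : 1 ≤ n) {δ : ℝ} {T : Finset (Equiv.Perm (Fin n))}
    (hT : ∀ σ ∈ T, Avoids231 σ ∧ ∃ ψ : Espace,
      completedGraph (fcurve σ) = excursionGraph ⇑ψ.1 ∧ dist ψ.1 φ.1 ≤ δ) :
    (T.card : ℝ) ≤ Real.exp (2 * n * Real.log 2
      - 2 * n / m * ∑ i ∈ Finset.range m,
        (lam i * (m * (φ.1 ((i + 1 : ℕ) / m) - φ.1 ((i : ℕ) / m))) - Real.log (Real.cosh (lam i)))
      + (∑ i ∈ Finset.range m, |lam i|) * (4 * n * δ + 2 * m)) := by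
  have hn0 : (0 : ℝ) < n := by exact_mod_cast hn
  have hm0 : (0 : ℝ) < m := by exact_mod_cast hm
  set L := 2 * n / m
  have hmL : m * L ≤ 2 * n := Nat.mul_div_le _ _
  have hmL' : 2 * n < m * L + m := by
    have := Nat.lt_mul_div_succ (2 * n) hm
    rwa [Nat.mul_add_one] at this
  have hmLr : (m : ℝ) * L ≤ 2 * n := by exact_mod_cast hmL
  have hmLr' : (2 : ℝ) * n < m * L + m := by exact_mod_cast hmL'
  have hinj : Set.InjOn (upSet (n := n)) T := fun σ hσ τ hτ h =>
    (hT σ hσ).1.eq_of_upSet_eq (hT τ hτ).1 h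
  have hpt : ∀ σ ∈ T, ∀ i ≤ m,
      |pathHeight (upSet σ) (i * L) - 2 * n * φ.1 ((i : ℕ) / m)| ≤ 2 * n * δ + m := by
    intro σ hσ i hi
    obtain ⟨-, ψ, hψ, hd⟩ := hT σ hσ
    have hir : (i : ℝ) ≤ m := by exact_mod_cast hi
    have h1 := apply_eq_pathHeight hn hψ ((Nat.mul_le_mul_right L hi).trans hmL)
    rw [eq_div_iff (by positivity)] at h1
    rw [← h1, mul_comm (ψ.1 _), ← mul_sub, abs_mul, abs_of_pos (by positivity : (0:ℝ) < 2 * n)]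
    have h2 : |ψ.1 (((i * L : ℕ) : ℝ) / (2 * n)) - φ.1 (((i * L : ℕ) : ℝ) / (2 * n))| ≤ δ := by
      rw [← Real.dist_eq]
      exact (BoundedContinuousFunction.dist_coe_le_dist _).trans hd
    have h3 := φ.abs_sub_le (((i * L : ℕ) : ℝ) / (2 * n)) ((i : ℝ) / m)
    have h4 : |((i * L : ℕ) : ℝ) / (2 * n) - (i : ℝ) / m| ≤ m / (2 * n) := by
      have : ((i * L : ℕ) : ℝ) / (2 * n) - (i : ℝ) / m =
          -((i : ℝ) / m * ((2 * n - m * L) / (2 * n))) := by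
        push_cast; field_simp; ring
      rw [this, abs_neg, abs_of_nonneg
        (mul_nonneg (by positivity) (div_nonneg (by linarith) (by positivity)))]
      calc (i : ℝ) / m * ((2 * n - m * L) / (2 * n)) ≤ 1 * (m / (2 * n)) := by
            refine mul_le_mul ((div_le_one hm0).2 hir) ?_
              (div_nonneg (by linarith) (by positivity)) zero_le_one
            gcongr
            linarith
        _ = _ := one_mul _
    have h5 := abs_sub_le (ψ.1 (((i * L : ℕ) : ℝ) / (2 * n)))
      (φ.1 (((i * L : ℕ) : ℝ) / (2 * n))) (φ.1 ((i : ℝ) / m))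
    calc _ ≤ 2 * n * (δ + m / (2 * n)) := by gcongr; linarith
      _ = _ := by field_simp
  set S := ∑ i ∈ Finset.range m, |lam i|
  set Y := ∑ i ∈ Finset.range m, lam i * (φ.1 ((i + 1 : ℕ) / m) - φ.1 ((i : ℕ) / m))
  have hc : ∀ U ∈ T.image upSet, 2 * n * Y - S * (4 * n * δ + 2 * m) ≤
      ∑ i ∈ Finset.range m, lam i * (pathHeight U ((i + 1) * L) - pathHeight U (i * L)) := by
    intro U hU
    obtain ⟨σ, hσ, rfl⟩ := Finset.mem_image.1 hU
    rw [Finset.mul_sum, Finset.sum_mul, ← Finset.sum_sub_distrib]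
    refine Finset.sum_le_sum fun i hi => ?_
    have hi := Finset.mem_range.1 hi
    have h1 := abs_le.1 (hpt σ hσ i hi.le)
    have h2 := abs_le.1 (hpt σ hσ (i + 1) hi)
    set a := pathHeight (upSet σ) ((i + 1) * L)
    set b := pathHeight (upSet σ) (i * L)
    set p := φ.1 (((i + 1 : ℕ) : ℝ) / m)
    set q := φ.1 ((i : ℝ) / m)
    have h3 : |(2 * n * (p - q)) - (a - b)| ≤ 4 * n * δ + 2 * m := by
      rw [abs_le]; constructor <;> linarith [h1.1, h1.2, h2.1, h2.2]
    have h4 := le_abs_self (lam i * (2 * n * (p - q) - (a - b)))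
    rw [abs_mul] at h4
    have h5 := mul_le_mul_of_nonneg_left h3 (abs_nonneg (lam i))
    linarith
  have hmain := card_mul_exp_le_prod_cosh_pow hmL (T := T.image upSet)
    (fun U hU => by obtain ⟨σ, -, rfl⟩ := Finset.mem_image.1 hU; exact upSet_subset σ) lam hc
  rw [Finset.card_image_of_injOn hinj] at hmain
  have hprod : ∏ i ∈ Finset.range m, Real.cosh (lam i) ^ L ≤
      Real.exp (2 * n / m * ∑ i ∈ Finset.range m, Real.log (Real.cosh (lam i))) := by
    rw [Finset.mul_sum, Real.exp_sum]
    refine Finset.prod_le_prod (fun i _ => by positivity) fun i _ => ?_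
    rw [← Real.exp_log (Real.cosh_pos (lam i)), ← Real.exp_nat_mul, Real.log_exp]
    refine Real.exp_le_exp.2 (mul_le_mul_of_nonneg_right ?_ (Real.log_nonneg (Real.one_le_cosh _)))
    rw [le_div_iff₀ hm0]; linarith
  have h2 : (2 : ℝ) ^ (2 * n) = Real.exp (2 * n * Real.log 2) := by
    have := Real.exp_nat_mul (Real.log 2) (2 * n)
    rw [Real.exp_log two_pos] at this
    rw [← this]
    push_cast; rfl
  rw [h2] at hmain
  have h3 := hmain.trans (mul_le_mul_of_nonneg_left hprod (Real.exp_pos _).le)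
  rw [← Real.exp_add, ← le_div_iff₀ (Real.exp_pos _), ← Real.exp_sub] at h3
  refine h3.trans (Real.exp_le_exp.2 (le_of_eq ?_))
  rw [Finset.sum_sub_distrib]
  have hY : ∑ i ∈ Finset.range m,
      lam i * (m * (φ.1 ((i + 1 : ℕ) / m) - φ.1 ((i : ℕ) / m))) = m * Y := by
    rw [Finset.mul_sum]; exact Finset.sum_congr rfl fun i _ => by ring
  rw [hY]
  field_simp
  ring

end UpperBound

section Weights

/-- The total weight of the `231`-avoiding permutations whose excursion lies in `S`. -/
def weight231 (β : ℝ) (phi : ∀ n : ℕ, Equiv.Perm (Fin n) → Espace) (n : ℕ) (S : Set Espace) : ℝ :=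
  ∑ σ ∈ Finset.univ.filter (fun σ : Equiv.Perm (Fin n) => Avoids231 σ ∧ phi n σ ∈ S),
    Real.exp (β / n * invCount σ)

variable (β : ℝ) (phi : ∀ n : ℕ, Equiv.Perm (Fin n) → Espace)

theorem weight231_mono (n : ℕ) {S T : Set Espace} (h : S ⊆ T) :
    weight231 β phi n S ≤ weight231 β phi n T := by
  refine Finset.sum_le_sum_of_subset_of_nonneg (fun σ => ?_) fun _ _ _ => (Real.exp_pos _).le
  simp only [Finset.mem_filter]
  exact fun hσ => ⟨hσ.1, hσ.2.1, h hσ.2.2⟩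

theorem weight231_union_le (n : ℕ) (S T : Set Espace) :
    weight231 β phi n (S ∪ T) ≤ weight231 β phi n S + weight231 β phi n T := by
  rw [weight231, weight231, weight231, ← Finset.sum_union_inter]
  refine le_add_of_le_of_nonneg
    (Finset.sum_le_sum_of_subset_of_nonneg (fun σ => ?_) fun _ _ _ => (Real.exp_pos _).le)
    (Finset.sum_nonneg fun _ _ => (Real.exp_pos _).le)
  simp only [Finset.mem_filter, Finset.mem_union, Set.mem_union]
  tauto

theorem weight231_empty (n : ℕ) : weight231 β phi n ∅ = 0 := by simp [weight231]

theorem weight231_univ (n : ℕ) : weight231 β phi n univ = Z231 β n := by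
  simp [weight231, Z231]

theorem probMallows231_eq (n : ℕ) (S : Set Espace) :
    probMallows231 β phi n S =
      ENNReal.ofReal (weight231 β phi n S) / ENNReal.ofReal (weight231 β phi n univ) := by
  rw [weight231_univ, probMallows231, weight231,
    ENNReal.ofReal_sum_of_nonneg fun _ _ => (Real.exp_pos _).le]

variable {β phi}

theorem eventually_weight231_le
    (hphi : ∀ n : ℕ, 1 ≤ n → ∀ σ : Equiv.Perm (Fin n), Avoids231 σ →
      completedGraph (fcurve σ) = excursionGraph ⇑(phi n σ).1)
    (φ : Espace) {ε : ℝ} (hε : 0 < ε) :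
    ∃ U ∈ nhds φ, ∀ᶠ n : ℕ in atTop,
      weight231 β phi n U ≤ Real.exp (n * (2 * Real.log 2 - A231 β φ + ε)) := by
  set H := ∫ t in (0 : ℝ)..1, Jfun (deriv (⇑φ.1) t) with hH
  obtain ⟨m, hmH, hm⟩ := (((tendsto_blockEntropy φ.lipschitz).eventually
    (lt_mem_nhds (show H - ε / 8 < H by linarith))).and (eventually_gt_atTop 0)).exists
  have hm0 : (0 : ℝ) < m := by exact_mod_cast hm
  choose lam hlam using fun i : ℕ =>
    exists_Jfun_sub_le (abs_mul_sub_le_one φ.lipschitz m i) (show 0 < ε / 8 by positivity)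
  set S := ∑ i ∈ Finset.range m, |lam i|
  have hS : 0 ≤ S := Finset.sum_nonneg fun _ _ => abs_nonneg _
  have hD : 0 < 4 * (4 * S + 2 * |β| + 1) := by positivity
  set δ := ε / (4 * (4 * S + 2 * |β| + 1)) with hδ
  have hδ0 : 0 < δ := div_pos hε hD
  have hδε : (4 * S + 2 * |β|) * δ ≤ ε / 4 := by
    have : (4 * S + 2 * |β| + 1) * δ = ε / 4 := by rw [hδ]; field_simp
    linarith
  refine ⟨_, φ.closedBall_mem_nhds hδ0, ?_⟩
  filter_upwards [eventually_ge_atTop 1,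
    tendsto_natCast_atTop_atTop.eventually_ge_atTop ((2 * m * S + 2 * |β|) / (ε / 4))]
    with n hn hnε
  have hn0 : (0 : ℝ) < n := by exact_mod_cast hn
  rw [div_le_iff₀ (by positivity)] at hnε
  set T := Finset.univ.filter
    fun σ : Equiv.Perm (Fin n) => Avoids231 σ ∧ phi n σ ∈ {ψ : Espace | dist ψ.1 φ.1 ≤ δ}
  have hT : ∀ σ ∈ T, Avoids231 σ ∧ dist (phi n σ).1 φ.1 ≤ δ := fun σ hσ => by
    simpa [T] using hσ
  have hcard := card_le_exp_of_dist_le φ hm lam hn (δ := δ) (T := T) fun σ hσ =>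
    ⟨(hT σ hσ).1, _, hphi n hn σ (hT σ hσ).1, (hT σ hσ).2⟩
  have hsum : m * (H - ε / 4) ≤ ∑ i ∈ Finset.range m,
      (lam i * (m * (φ.1 ((i + 1 : ℕ) / m) - φ.1 ((i : ℕ) / m))) -
        Real.log (Real.cosh (lam i))) := by
    have h1 := Finset.sum_le_sum fun i (_ : i ∈ Finset.range m) => hlam i
    rw [Finset.sum_sub_distrib, Finset.sum_const, Finset.card_range, nsmul_eq_mul] at h1
    refine le_trans ?_ h1
    have h2 := hmH
    rw [blockEntropy, lt_div_iff₀ hm0] at h2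
    linarith
  have hsum' := mul_le_mul_of_nonneg_left hsum (by positivity : 0 ≤ 2 * (n : ℝ) / m)
  rw [show 2 * (n : ℝ) / m * (m * (H - ε / 4)) = 2 * n * (H - ε / 4) by field_simp] at hsum'
  set I := ∫ t in (0 : ℝ)..1, φ.1 t with hI
  have hle : weight231 β phi n {ψ : Espace | dist ψ.1 φ.1 ≤ δ} ≤
      T.card * Real.exp (n * (2 * β * I) + |β| * (2 * δ * n + 2)) := by
    rw [← nsmul_eq_mul]
    refine Finset.sum_le_card_nsmul _ _ _ fun σ hσ => Real.exp_le_exp.2 ?_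
    have h1 := (abs_le.1 ((hT σ hσ).1.abs_tilt_sub_le β hn (hphi n hn σ (hT σ hσ).1)
      (hT σ hσ).2)).2
    linarith
  refine hle.trans ((mul_le_mul_of_nonneg_right hcard (Real.exp_pos _).le).trans ?_)
  rw [← Real.exp_add, A231, H231, ← hH, ← hI]
  refine Real.exp_le_exp.2 ?_
  have h1 := mul_le_mul_of_nonneg_left hδε hn0.le
  nlinarith

end Weights

section LowerBound

theorem upCount_range {K j : ℕ} (hj : j ≤ K) : upCount (Finset.range K) j = j := by
  have : (Finset.range K).filter (· < j) = Finset.range j := by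
    ext x; simp only [Finset.mem_filter, Finset.mem_range]; omega
  rw [upCount, this, Finset.card_range]

/-- The family of all paths that start with `K` up-steps and then make `a i` up-steps in the
`i`-th block of length `L`. -/
theorem exists_blockFamily (K L : ℕ) (a : ℕ → ℕ) (M : ℕ) :
    ∃ F : Finset (Finset ℕ), F.card = ∏ i ∈ Finset.range M, L.choose (a i) ∧
      ∀ U ∈ F, U ⊆ Finset.range (K + M * L) ∧ (∀ j ≤ K, upCount U j = j) ∧
        ∀ i ≤ M, upCount U (K + i * L) = K + ∑ i' ∈ Finset.range i, a i' := by
  induction M with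
  | zero =>
    refine ⟨{Finset.range K}, by simp, fun U hU => ?_⟩
    rw [Finset.mem_singleton.1 hU]
    refine ⟨by simp, fun j hj => upCount_range hj, fun i hi => ?_⟩
    rw [Nat.le_zero.1 hi]
    simpa using upCount_range le_rfl
  | succ M ih =>
    obtain ⟨F, hF, hFU⟩ := ih
    set N := K + M * L
    set P := F ×ˢ (Finset.Ico N (N + L)).powersetCard (a M)
    have hP : ∀ p ∈ P, p.1 ∈ F ∧ p.2 ⊆ Finset.Ico N (N + L) ∧ p.2.card = a M := fun p hp => by
      simpa [P, Finset.mem_product, Finset.mem_powersetCard] using hp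
    have hlow : ∀ p ∈ P, ∀ j ≤ N, (p.1 ∪ p.2).filter (· < j) = p.1.filter (· < j) := by
      intro p hp j hj
      ext x
      simp only [Finset.mem_filter, Finset.mem_union]
      constructor
      · rintro ⟨h | h, hx⟩
        · exact ⟨h, hx⟩
        · have := Finset.mem_Ico.1 ((hP p hp).2.1 h)
          omega
      · exact fun h => ⟨Or.inl h.1, h.2⟩
    have hfst : ∀ p ∈ P, p.1.filter (· < N) = p.1 := fun p hp =>
      Finset.filter_true_of_mem fun x hx =>
        Finset.mem_range.1 ((hFU p.1 (hP p hp).1).1 hx)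
    have hdisj : ∀ p ∈ P, Disjoint p.1 p.2 := fun p hp =>
      Finset.disjoint_left.2 fun x hx hx' => by
        have h1 := Finset.mem_range.1 ((hFU p.1 (hP p hp).1).1 hx)
        have h2 := Finset.mem_Ico.1 ((hP p hp).2.1 hx')
        omega
    refine ⟨P.image fun p => p.1 ∪ p.2, ?_, fun U hU => ?_⟩
    · rw [Finset.card_image_of_injOn, Finset.card_product, Finset.card_powersetCard,
        Nat.card_Ico, Nat.add_sub_cancel_left, hF, Finset.prod_range_succ]
      intro p hp q hq h
      have h1 : p.1 = q.1 := by
        rw [← hfst p hp, ← hfst q hq, ← hlow p hp N le_rfl, ← hlow q hq N le_rfl]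
        exact congrArg (Finset.filter (· < N)) h
      refine Prod.ext h1 ?_
      have h2 : (p.1 ∪ p.2) \ p.1 = (q.1 ∪ q.2) \ q.1 := by
        rw [show p.1 ∪ p.2 = q.1 ∪ q.2 from h, h1]
      rwa [Finset.union_sdiff_cancel_left (hdisj p hp),
        Finset.union_sdiff_cancel_left (hdisj q hq)] at h2
    · obtain ⟨p, hp, rfl⟩ := Finset.mem_image.1 hU
      obtain ⟨hpF, hpI, hpc⟩ := hP p hp
      obtain ⟨hsub, hK, hblk⟩ := hFU p.1 hpF
      have hN : K + (M + 1) * L = N + L := by simp only [N]; ring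
      have hsub' : p.1 ∪ p.2 ⊆ Finset.range (N + L) := by
        refine Finset.union_subset (fun x hx => ?_) fun x hx => ?_
        · have := Finset.mem_range.1 (hsub hx)
          exact Finset.mem_range.2 (by omega)
        · exact Finset.mem_range.2 (Finset.mem_Ico.1 (hpI hx)).2
      have hup : ∀ j ≤ N, upCount (p.1 ∪ p.2) j = upCount p.1 j := fun j hj => by
        rw [upCount, hlow p hp j hj, upCount]
      refine ⟨hN ▸ hsub', fun j hj => ?_, fun i hi => ?_⟩
      · rw [hup j (by omega), hK j hj]
      · rcases Nat.le_succ_iff.1 hi with hi | rfl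
        · rw [hup _ (Nat.add_le_add_left (Nat.mul_le_mul_right _ hi) _), hblk i hi]
        · rw [hN, upCount_of_subset hsub', Finset.card_union_of_disjoint (hdisj p hp), hpc,
            ← upCount_of_subset hsub, hblk M le_rfl, Finset.sum_range_succ, add_assoc]

theorem Espace.dist_le_of_block {φ ψ : Espace} {M l K n : ℕ} (hM : 0 < M) (hn : 1 ≤ n)
    (hK : K + M * l = n)
    (h : ∀ i ≤ M, |ψ.1 (((K + i * (2 * l) : ℕ) : ℝ) / (2 * n)) -
      (K + 2 * (M * φ.1 ((i : ℕ) / M) * l)) / (2 * n)| ≤ 1 / n) :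
    dist ψ.1 φ.1 ≤ 2 / M + 3 * (K / n) + 1 / n := by
  have hn0 : (0 : ℝ) < n := by exact_mod_cast hn
  have hM0 : (0 : ℝ) < M := by exact_mod_cast hM
  have hKr : (M : ℝ) * l = n - K := by
    rw [← hK]; push_cast; ring
  rw [BoundedContinuousFunction.dist_le (by positivity)]
  intro t
  by_cases ht : t ∈ Icc (0 : ℝ) 1
  swap
  · rw [ψ.apply_of_notMem ht, φ.apply_of_notMem ht, dist_self]
    positivity
  set i := ⌊t * M⌋₊
  have htM : 0 ≤ t * M := mul_nonneg ht.1 hM0.le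
  have hi1 : (i : ℝ) ≤ t * M := Nat.floor_le htM
  have hi2 : t * M < i + 1 := Nat.lt_floor_add_one _
  have hiM' : (i : ℝ) ≤ M := hi1.trans (mul_le_of_le_one_left hM0.le ht.2)
  have hiM : i ≤ M := by exact_mod_cast hiM'
  have h0 := h i hiM
  set x : ℝ := (i : ℝ) / M
  set p : ℝ := ((K + i * (2 * l) : ℕ) : ℝ) / (2 * n)
  have hx0 : 0 ≤ x := by positivity
  have hx1 : x ≤ 1 := (div_le_one hM0).2 hiM'
  have hk0 : (0 : ℝ) ≤ K / n := by positivity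
  have hxt : |t - x| ≤ 1 / M := by
    have : t - x = (t * M - i) / M := by simp only [x]; field_simp
    rw [this, abs_of_nonneg (div_nonneg (by linarith) hM0.le)]
    gcongr
    linarith
  have hlr : (l : ℝ) = (n - K) / M := by rw [eq_div_iff hM0.ne']; linarith
  have hpx : |x - p| ≤ K / n := by
    have : x - p = K / n * (x - 1 / 2) := by
      simp only [x, p]; push_cast; rw [hlr]; field_simp; ring
    rw [this, abs_mul, abs_of_nonneg hk0]
    exact mul_le_of_le_one_right hk0 (abs_le.2 ⟨by linarith, by linarith⟩)
  have hval : |(K + 2 * (M * φ.1 x * l)) / (2 * n) - φ.1 x| ≤ K / n := by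
    have : (K + 2 * (M * φ.1 x * l)) / (2 * n) - φ.1 x = K / n * (1 / 2 - φ.1 x) := by
      rw [hlr]; field_simp; ring
    rw [this, abs_mul, abs_of_nonneg hk0]
    exact mul_le_of_le_one_right hk0
      (abs_le.2 ⟨by linarith [φ.apply_le_one x], by linarith [φ.nonneg x]⟩)
  have h1 := ψ.abs_sub_le t p
  have h2 := φ.abs_sub_le x t
  rw [abs_sub_comm x t] at h2
  have h3 := _root_.abs_sub_le t x p
  have h4 := _root_.abs_sub_le (ψ.1 t) (ψ.1 p) (φ.1 t)
  have h5 := _root_.abs_sub_le (ψ.1 p) (((K : ℝ) + 2 * (M * φ.1 x * l)) / (2 * n)) (φ.1 t)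
  have h6 := _root_.abs_sub_le (((K : ℝ) + 2 * (M * φ.1 x * l)) / (2 * n)) (φ.1 x) (φ.1 t)
  rw [Real.dist_eq]
  have : (2 : ℝ) / M = 1 / M + 1 / M := by ring
  linarith

end LowerBound

section Counting

/-- The number of up-steps in the `i`-th block of length `2 * l` of a path approximating `φ`. -/
def blockUp (φ : Espace) (M l i : ℕ) : ℕ :=
  l + ⌊M * φ.1 ((i + 1 : ℕ) / M) * l⌋₊ - ⌊M * φ.1 ((i : ℕ) / M) * l⌋₊

theorem Espace.floor_le_floor_add (φ : Espace) {M : ℕ} (hM : 0 < M) (l : ℕ) {i j : ℕ}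
    (hij : |(i : ℝ) - j| ≤ 1) :
    ⌊M * φ.1 ((i : ℕ) / M) * l⌋₊ ≤ ⌊M * φ.1 ((j : ℕ) / M) * l⌋₊ + l := by
  have hM0 : (0 : ℝ) < M := by exact_mod_cast hM
  rw [← Nat.floor_add_natCast (mul_nonneg (mul_nonneg hM0.le (φ.nonneg _)) l.cast_nonneg)]
  refine Nat.floor_le_floor ?_
  have h1 := (le_abs_self _).trans (φ.abs_sub_le ((i : ℝ) / M) ((j : ℝ) / M))
  rw [← sub_div, abs_div, abs_of_pos hM0, le_div_iff₀ hM0] at h1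
  have h2 := mul_le_mul_of_nonneg_right (h1.trans hij) l.cast_nonneg (α := ℝ)
  linarith

theorem blockUp_add (φ : Espace) {M : ℕ} (hM : 0 < M) (l i : ℕ) :
    blockUp φ M l i + ⌊M * φ.1 ((i : ℕ) / M) * l⌋₊ =
      l + ⌊M * φ.1 ((i + 1 : ℕ) / M) * l⌋₊ := by
  have := φ.floor_le_floor_add hM l (i := i) (j := i + 1) (by push_cast; simp)
  rw [blockUp]; omega

theorem blockUp_le (φ : Espace) {M : ℕ} (hM : 0 < M) (l i : ℕ) : blockUp φ M l i ≤ 2 * l := by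
  have h1 := φ.floor_le_floor_add hM l (i := i + 1) (j := i) (by push_cast; simp)
  have h2 := blockUp_add φ hM l i
  omega

theorem sum_blockUp (φ : Espace) {M : ℕ} (hM : 0 < M) (l k : ℕ) :
    ∑ i ∈ Finset.range k, blockUp φ M l i = k * l + ⌊M * φ.1 ((k : ℕ) / M) * l⌋₊ := by
  induction k with
  | zero => simp [φ.apply_zero]
  | succ k ih =>
    have := blockUp_add φ hM l k
    rw [Finset.sum_range_succ, ih, Nat.succ_mul]; omega

theorem prod_choose_blockUp_le_card (φ : Espace) {M l K n : ℕ} (hM : 0 < M) (hn : 1 ≤ n)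
    (hK : K + M * l = n) (hlK : 2 * l ≤ K) {δ : ℝ}
    (hδ : 2 / M + 3 * (K / n) + 1 / n ≤ δ) {T : Finset (Equiv.Perm (Fin n))}
    {f : Equiv.Perm (Fin n) → Espace}
    (hf : ∀ σ, Avoids231 σ → completedGraph (fcurve σ) = excursionGraph ⇑(f σ).1)
    (hT : ∀ σ, Avoids231 σ → dist (f σ).1 φ.1 ≤ δ → σ ∈ T) :
    ∏ i ∈ Finset.range M, (2 * l).choose (blockUp φ M l i) ≤ T.card := by
  have hn0 : (0 : ℝ) < n := by exact_mod_cast hn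
  have hM0 : (0 : ℝ) < M := by exact_mod_cast hM
  obtain ⟨F, hF, hFU⟩ := exists_blockFamily K (2 * l) (blockUp φ M l) M
  rw [← hF]
  refine (Finset.card_le_card fun U hU => ?_).trans (Finset.card_image_le (s := T) (f := upSet))
  obtain ⟨hsub, hUK, hUb⟩ := hFU U hU
  simp only [sum_blockUp φ hM] at hUb
  have hend : upCount U (K + M * (2 * l)) = n := by
    rw [hUb M le_rfl, div_self hM0.ne', φ.apply_one]
    simp [hK]
  have hle : K + M * (2 * l) ≤ 2 * n := by
    rw [← hK]; ring_nf; omega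
  have hU2 : U ⊆ Finset.range (2 * n) := hsub.trans (Finset.range_subset_range.2 hle)
  have hcard : U.card = n := by rw [← upCount_of_subset hsub, hend]
  have hpos : ∀ j ≤ 2 * n, j ≤ 2 * upCount U j := by
    intro j hj
    rcases le_total j K with h | h
    · rw [hUK j h]; omega
    rcases le_or_gt (K + M * (2 * l)) j with h' | h'
    · have := upCount_mono U h'
      omega
    · obtain ⟨r, rfl⟩ := Nat.exists_eq_add_of_le h
      have hl : 0 < 2 * l := by
        rcases Nat.eq_zero_or_pos (2 * l) with h0 | h0
        · rw [h0] at h'; omega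
        · exact h0
      have h1 : r / (2 * l) < M := by
        rw [Nat.div_lt_iff_lt_mul hl]; omega
      have h2 := hUb _ h1.le
      have h3 : r / (2 * l) * (2 * l) ≤ r := Nat.div_mul_le_self _ _
      have h4 : r < r / (2 * l) * (2 * l) + 2 * l := Nat.lt_div_mul_add hl
      have h5 := upCount_mono U (Nat.add_le_add_left h3 K)
      have h6 : r / (2 * l) * (2 * l) = 2 * (r / (2 * l) * l) := by ring
      omega
  obtain ⟨σ, hσ, hσU⟩ := exists_avoids231_upSet_eq hU2 hcard hpos
  refine Finset.mem_image.2 ⟨σ, hT σ hσ (le_trans ?_ hδ), hσU⟩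
  refine Espace.dist_le_of_block hM hn hK fun i hi => ?_
  have hi2 : K + i * (2 * l) ≤ 2 * n :=
    (Nat.add_le_add_left (Nat.mul_le_mul_right _ hi) _).trans hle
  rw [apply_eq_pathHeight hn (hf σ hσ) hi2, hσU, pathHeight, hUb i hi, ← sub_div, abs_div,
    abs_of_pos (by positivity : (0 : ℝ) < 2 * n), div_le_div_iff₀ (by positivity) hn0]
  have hx : 0 ≤ M * φ.1 ((i : ℕ) / M) * l :=
    mul_nonneg (mul_nonneg hM0.le (φ.nonneg _)) l.cast_nonneg
  have h1 := Nat.floor_le hx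
  have h2 := Nat.lt_floor_add_one (M * φ.1 ((i : ℕ) / M) * l)
  set D := ⌊M * φ.1 ((i : ℕ) / M) * l⌋₊
  rw [one_mul]
  refine mul_le_mul_of_nonneg_right ?_ hn0.le
  push_cast
  rw [abs_le]
  constructor <;> linarith

end Counting

section Asymptotics

theorem tendsto_natDiv_div (c : ℕ) :
    Tendsto (fun n : ℕ => ((n / c : ℕ) : ℝ) / n) atTop (nhds (1 / c)) := by
  have h := (tendsto_nat_floor_mul_div_atTop (R := ℝ) (a := 1 / c) (by positivity)).comp
    tendsto_natCast_atTop_atTop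
  refine h.congr fun n => ?_
  simp only [Function.comp]
  rw [one_div_mul_eq_div, Nat.floor_div_natCast, Nat.floor_natCast]

theorem tendsto_log_two_mul_add_one_div :
    Tendsto (fun l : ℕ => Real.log (2 * l + 1) / l) atTop (nhds 0) := by
  have h1 : Tendsto (fun l : ℕ => (2 * l + 1 : ℝ)) atTop atTop :=
    tendsto_atTop_add_const_right _ _
      (tendsto_natCast_atTop_atTop.const_mul_atTop (by norm_num : (0 : ℝ) < 2))
  have h2 := (Real.isLittleO_log_id_atTop.tendsto_div_nhds_zero).comp h1
  have h3 : Tendsto (fun l : ℕ => 2 + 1 / (l : ℝ)) atTop (nhds (2 + 0)) :=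
    tendsto_one_div_atTop_nhds_zero_nat.const_add 2
  have h4 := h2.mul h3
  rw [zero_mul] at h4
  refine h4.congr' ?_
  filter_upwards [eventually_gt_atTop 0] with l hl
  have hl0 : (0 : ℝ) < l := by exact_mod_cast hl
  simp only [Function.comp, id]
  field_simp

theorem tendsto_blockUp (φ : Espace) {M : ℕ} (hM : 0 < M) (i : ℕ) :
    Tendsto (fun l : ℕ => ((blockUp φ M l i : ℝ) - l) / l) atTop
      (nhds (M * (φ.1 ((i + 1 : ℕ) / M) - φ.1 ((i : ℕ) / M)))) := by
  have h : ∀ j : ℕ, Tendsto (fun l : ℕ => (⌊M * φ.1 ((j : ℕ) / M) * l⌋₊ : ℝ) / l) atTop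
      (nhds (M * φ.1 ((j : ℕ) / M))) := fun j =>
    (tendsto_nat_floor_mul_div_atTop (R := ℝ) (mul_nonneg M.cast_nonneg (φ.nonneg _))).comp
      tendsto_natCast_atTop_atTop
  rw [mul_sub]
  refine ((h (i + 1)).sub (h i)).congr fun l => ?_
  have h1 := congrArg (Nat.cast (R := ℝ)) (blockUp_add φ hM l i)
  push_cast at h1
  rw [← sub_div]
  congr 1
  push_cast
  linarith

theorem eventually_le_sum_log_choose (φ : Espace) {M : ℕ} (hM : 0 < M) {x : ℝ}
    (hx : x < 2 * M / (M + 2) * (Real.log 2 - blockEntropy φ.1 M)) :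
    ∀ᶠ n : ℕ in atTop, Real.exp (n * x) ≤
      ((∏ i ∈ Finset.range M,
        (2 * (n / (M + 2))).choose (blockUp φ M (n / (M + 2)) i) : ℕ) : ℝ) := by
  have hM0 : (0 : ℝ) < M := by exact_mod_cast hM
  have hl : Tendsto (fun n : ℕ => n / (M + 2)) atTop atTop :=
    Nat.tendsto_div_const_atTop (by omega)
  have hlim : Tendsto (fun l : ℕ => ∑ i ∈ Finset.range M,
      (2 * (Real.log 2 - Jfun (((blockUp φ M l i : ℝ) - l) / l)) - Real.log (2 * l + 1) / l))
      atTop (nhds (∑ i ∈ Finset.range M, (2 * (Real.log 2 -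
        Jfun (M * (φ.1 ((i + 1 : ℕ) / M) - φ.1 ((i : ℕ) / M)))) - 0))) :=
    tendsto_finsetSum _ fun i _ =>
      (((continuous_Jfun.tendsto _).comp (tendsto_blockUp φ hM i)).const_sub _ |>.const_mul 2).sub
        tendsto_log_two_mul_add_one_div
  have hlim2 := (tendsto_natDiv_div (M + 2)).mul (hlim.comp hl)
  have heq : 1 / ((M + 2 : ℕ) : ℝ) * ∑ i ∈ Finset.range M, (2 * (Real.log 2 -
        Jfun (M * (φ.1 ((i + 1 : ℕ) / M) - φ.1 ((i : ℕ) / M)))) - 0) =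
      2 * M / (M + 2) * (Real.log 2 - blockEntropy φ.1 M) := by
    simp only [sub_zero]
    rw [← Finset.mul_sum, Finset.sum_sub_distrib, Finset.sum_const, Finset.card_range,
      nsmul_eq_mul, blockEntropy]
    push_cast
    field_simp
  rw [heq] at hlim2
  filter_upwards [hlim2.eventually (lt_mem_nhds hx), eventually_gt_atTop 0,
    hl.eventually_gt_atTop 0] with n hn hn0 hl0
  have hn0' : (0 : ℝ) < n := by exact_mod_cast hn0
  simp only [Function.comp] at hn
  set l := n / (M + 2)
  have hl0' : (0 : ℝ) < l := by exact_mod_cast hl0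
  have hpos : ∀ i, (0 : ℝ) < ((2 * l).choose (blockUp φ M l i) : ℕ) := fun i => by
    exact_mod_cast Nat.choose_pos (blockUp_le φ hM l i)
  push_cast
  rw [← Real.exp_log (Finset.prod_pos fun i _ => hpos i), Real.exp_le_exp,
    Real.log_prod fun i _ => (hpos i).ne']
  refine le_trans ?_ (Finset.sum_le_sum fun i _ =>
    entropy_le_log_choose hl0 (blockUp_le φ hM l i))
  have h1 := mul_le_mul_of_nonneg_left hn.le hn0'.le
  refine h1.trans (le_of_eq ?_)
  rw [← mul_assoc, mul_div_cancel₀ _ hn0'.ne', Finset.mul_sum]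
  refine Finset.sum_congr rfl fun i _ => ?_
  rw [mul_sub, mul_div_cancel₀ _ hl0'.ne']
  ring

theorem le_eventually_weight231 {β : ℝ} {phi : ∀ n : ℕ, Equiv.Perm (Fin n) → Espace}
    (hphi : ∀ n : ℕ, 1 ≤ n → ∀ σ : Equiv.Perm (Fin n), Avoids231 σ →
      completedGraph (fcurve σ) = excursionGraph ⇑(phi n σ).1)
    (φ : Espace) {U : Set Espace} (hU : U ∈ nhds φ) {ε : ℝ} (hε : 0 < ε) :
    ∀ᶠ n : ℕ in atTop,
      Real.exp (n * (2 * Real.log 2 - A231 β φ - ε)) ≤ weight231 β phi n U := by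
  obtain ⟨δ₀, hδ₀, hδU⟩ := Espace.exists_forall_dist_le_mem hU
  set δ := min δ₀ (ε / (6 * |β| + 6))
  have hδ : 0 < δ := lt_min hδ₀ (by positivity)
  have hδε : |β| * (2 * δ) ≤ ε / 3 := by
    have h1 : δ ≤ ε / (6 * |β| + 6) := min_le_right _ _
    rw [le_div_iff₀ (by positivity)] at h1
    linarith
  set H := ∫ t in (0 : ℝ)..1, Jfun (deriv (⇑φ.1) t) with hH
  set I := ∫ t in (0 : ℝ)..1, φ.1 t with hI
  have hratio : Tendsto (fun M : ℕ => 2 * (M : ℝ) / (M + 2)) atTop (nhds 2) := by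
    have := (tendsto_natCast_div_add_atTop (2 : ℝ)).const_mul 2
    simpa [mul_div_assoc] using this
  have hlim := hratio.mul ((tendsto_blockEntropy φ.lipschitz).const_sub (Real.log 2))
  obtain ⟨M, ⟨hMx, hMδ⟩, hM⟩ := (((hlim.eventually (lt_mem_nhds
    (show 2 * (Real.log 2 - H) - ε / 3 < 2 * (Real.log 2 - H) by linarith))).and
    (tendsto_natCast_atTop_atTop.eventually_ge_atTop (16 / δ))).and
    (eventually_gt_atTop 0)).exists
  have hM0 : (0 : ℝ) < M := by exact_mod_cast hM
  have hM8 : 8 / (M : ℝ) ≤ δ / 2 := by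
    rw [div_le_iff₀ hδ] at hMδ
    rw [div_le_iff₀ hM0]; linarith
  filter_upwards [eventually_le_sum_log_choose φ hM hMx, eventually_ge_atTop 1,
    tendsto_natCast_atTop_atTop.eventually_ge_atTop ((3 * M + 1) / (δ / 2)),
    tendsto_natCast_atTop_atTop.eventually_ge_atTop (2 * |β| / (ε / 3))] with n hcount hn hnM hnβ
  have hn0 : (0 : ℝ) < n := by exact_mod_cast hn
  rw [div_le_iff₀ (by positivity)] at hnM hnβ
  set l := n / (M + 2)
  have hl1 : l * (M + 2) ≤ n := Nat.div_mul_le_self _ _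
  have hl2 : n < l * (M + 2) + (M + 2) := Nat.lt_div_mul_add (by omega)
  have hl3 : M * l + 2 * l ≤ n := by linarith
  set K := n - M * l with hKdef
  have hK : K + M * l = n := by omega
  have hlK : 2 * l ≤ K := by omega
  have hclose : 2 / (M : ℝ) + 3 * (K / n) + 1 / n ≤ δ := by
    have hKr : (K : ℝ) = n - M * l := by rw [← hK]; push_cast; ring
    have hl2r : (n : ℝ) < l * (M + 2) + (M + 2) := by exact_mod_cast hl2
    have h1 : (K : ℝ) * M ≤ 2 * n + M * M := by
      rw [hKr]
      nlinarith
    have h2 : (K : ℝ) / n ≤ 2 / M + M / n := by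
      rw [div_add_div _ _ hM0.ne' hn0.ne', div_le_div_iff₀ hn0 (by positivity)]
      nlinarith
    have h3 : (3 * (M : ℝ) + 1) / n ≤ δ / 2 := by
      rw [div_le_iff₀ hn0]; linarith
    have h4 : (3 * (M : ℝ) + 1) / n = 3 * (M / n) + 1 / n := by ring
    have h5 : 8 / (M : ℝ) = 2 / M + 3 * (2 / M) := by ring
    linarith
  set T := Finset.univ.filter
    fun σ : Equiv.Perm (Fin n) => Avoids231 σ ∧ dist (phi n σ).1 φ.1 ≤ δ
  have hcard := prod_choose_blockUp_le_card φ hM hn hK hlK hclose (T := T) (hphi n hn)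
    fun σ h1 h2 => by simpa [T] using ⟨h1, h2⟩
  have hcard' : Real.exp (n * (2 * (Real.log 2 - H) - ε / 3)) ≤ T.card :=
    hcount.trans (by exact_mod_cast hcard)
  have hTU : ∀ σ ∈ T, Avoids231 σ ∧ dist (phi n σ).1 φ.1 ≤ δ := fun σ hσ => by
    simpa [T] using hσ
  have hle : T.card * Real.exp (n * (2 * β * I) - |β| * (2 * δ * n + 2)) ≤
      weight231 β phi n U := by
    rw [← nsmul_eq_mul]
    refine (Finset.card_nsmul_le_sum T (fun σ => Real.exp (β / n * invCount σ)) _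
      fun σ hσ => Real.exp_le_exp.2 ?_).trans
      (Finset.sum_le_sum_of_subset_of_nonneg (fun σ hσ => ?_) fun _ _ _ => (Real.exp_pos _).le)
    · have h1 := (abs_le.1 ((hTU σ hσ).1.abs_tilt_sub_le β hn (hphi n hn σ (hTU σ hσ).1)
        (hTU σ hσ).2)).1
      linarith
    · exact Finset.mem_filter.2 ⟨Finset.mem_univ _, (hTU σ hσ).1,
        hδU _ ((hTU σ hσ).2.trans (min_le_left _ _))⟩
  refine le_trans ?_ ((mul_le_mul_of_nonneg_right hcard' (Real.exp_pos _).le).trans hle)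
  rw [← Real.exp_add, A231, H231, ← hH, ← hI]
  refine Real.exp_le_exp.2 ?_
  have h1 := mul_le_mul_of_nonneg_left hδε hn0.le
  nlinarith

end Asymptotics

/-- Large deviation principle for the excursions of Mallows random permutations with
parameter `e^{β/n}` conditioned to avoid `231`, at speed `n`, with rate function
`φ ↦ A_β(φ) − inf_E A_β`. -/
theorem LDP_Mallows_231 (β : ℝ) (phi : ∀ n : ℕ, Equiv.Perm (Fin n) → Espace)
    (hphi : ∀ n : ℕ, 1 ≤ n → ∀ σ : Equiv.Perm (Fin n), Avoids231 σ →
      completedGraph (fcurve σ) = excursionGraph ⇑(phi n σ).1) :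
    SatisfiesLDP (probMallows231 β phi)
      (fun φ => ((A231 β φ - ⨅ ψ : Espace, A231 β ψ : ℝ) : EReal)) := by
  have h := satisfiesLDP_of_local (W := weight231 β phi)
    (fun n _ _ hST => weight231_mono β phi n hST) (weight231_union_le β phi)
    (weight231_empty β phi) (A231 β) (2 * Real.log 2)
    (fun φ _ hε => eventually_weight231_le hphi φ hε)
    (fun φ _ hU _ hε => le_eventually_weight231 hphi φ hU hε)
  rwa [show probMallows231 β phi = _ from
    funext fun n => funext fun S => probMallows231_eq β phi n S]

end
end

section
/- Fix β ∈ ℝ and define A_β on D by A_β(π₁,π₂) := H^{321}(π₁,π₂) − β·∫₀¹ x·(ρ₁(x) − ρ₂(x)) dx, where ρ₁, ρ₂ are the Lebesgue densities of π₁, π₂. Then A_β has a unique minimizer (π₁^{(β)}, π₂^{(β)}) in D. If β ≤ 0, then π₁^{(β)} = π₂^{(β)} = ½·Leb_{[0,1]}. If β > 0, then π₁^{(β)} and π₂^{(β)} have densities ρ₁^{(β)}(x) = 1/(1 + e^{β(1/2 − x)}) and ρ₂^{(β)}(x) = 1/(1 + e^{β(x − 1/2)}) on [0,1]; in particular both π₁^{(β)}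 and π₂^{(β)} have total mass 1/2. -/
open MeasureTheory Filter Set

noncomputable section

/-- Lebesgue measure on `[0,1]`. -/
def Leb01 : Measure ℝ := volume.restrict (Set.Icc (0:ℝ) 1)

/-- The set `D` of pairs of subuniform measures on `[0,1]` with equal total mass and
ordered cumulative distribution functions. -/
def Dset : Set (Measure ℝ × Measure ℝ) :=
  {p | p.1 ≤ Leb01 ∧ p.2 ≤ Leb01 ∧ p.1 Set.univ = p.2 Set.univ ∧
    ∀ x : ℝ, p.1 (Set.Icc 0 x) ≤ p.2 (Set.Icc 0 x)}

/-- The Lebesgue density of a (subuniform) measure on `[0,1]`. -/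
def dens (π : Measure ℝ) (x : ℝ) : ℝ := (π.rnDeriv volume x).toReal

/-- Entropy-type integrand: `ρ log ρ + (1−ρ) log(1−ρ) + log 2` (with `0 log 0 = 0`). -/
def entTerm (r : ℝ) : ℝ :=
  r * Real.log r + (1 - r) * Real.log (1 - r) + Real.log 2

/-- The entropy functional `H^{321}`. -/
def H321 (p : Measure ℝ × Measure ℝ) : ℝ :=
  ∫ x in Set.Icc (0:ℝ) 1, (entTerm (dens p.1 x) + entTerm (dens p.2 x))

/-- The action `A_β(π₁,π₂) = H^{321}(π₁,π₂) − β ∫₀¹ x (ρ₁(x) − ρ₂(x)) dx`. -/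
def A321 (β : ℝ) (p : Measure ℝ × Measure ℝ) : ℝ :=
  H321 p - β * ∫ x in Set.Icc (0:ℝ) 1, x * (dens p.1 x - dens p.2 x)

/-- The measure on `[0,1]` with logistic density of slope `c` centred at `1/2`. -/
def logisticMeasure (c : ℝ) : Measure ℝ :=
  Leb01.withDensity (fun x => ENNReal.ofReal (1 / (1 + Real.exp (c * (1 / 2 - x)))))

lemma entTerm_gibbs (t : ℝ) {r : ℝ} (h0 : 0 ≤ r) (h1 : r ≤ 1) :
    Real.log 2 - Real.log (1 + Real.exp t) ≤ entTerm r - t * r ∧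
      (entTerm r - t * r = Real.log 2 - Real.log (1 + Real.exp t) ↔
        r = 1 / (1 + Real.exp (-t))) := by
  set a := Real.exp t with ha
  have hapos : 0 < a := Real.exp_pos t
  have hne : (1 + a) ≠ 0 := by positivity
  have hs : 1 / (1 + Real.exp (-t)) = a / (1 + a) := by
    rw [Real.exp_neg, ← ha]; field_simp; ring
  have hta : t = Real.log a := by rw [ha, Real.log_exp]
  have hkl₁ : a / (1 + a) * InformationTheory.klFun (r * (1 + a) / a) =
      r * Real.log r + r * Real.log (1 + a) - t * r + a / (1 + a) - r := by
    rw [InformationTheory.klFun]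
    rcases h0.eq_or_lt with rfl | hr
    · simp
    · rw [Real.log_div (by positivity) hapos.ne', Real.log_mul hr.ne' hne, ← hta]
      field_simp
  have hkl₂ : 1 / (1 + a) * InformationTheory.klFun ((1 - r) * (1 + a)) =
      (1 - r) * Real.log (1 - r) + (1 - r) * Real.log (1 + a) + 1 / (1 + a) - (1 - r) := by
    rw [InformationTheory.klFun]
    rcases h1.eq_or_lt with rfl | hr
    · simp
    · rw [Real.log_mul (sub_pos.2 hr).ne' hne]
      field_simp
  have hone : a / (1 + a) + 1 / (1 + a) = 1 := by field_simp; ring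
  have hr' : 0 ≤ 1 - r := sub_nonneg.2 h1
  have hn₁ : 0 ≤ a / (1 + a) * InformationTheory.klFun (r * (1 + a) / a) :=
    mul_nonneg (by positivity) (InformationTheory.klFun_nonneg (by positivity))
  have hn₂ : 0 ≤ 1 / (1 + a) * InformationTheory.klFun ((1 - r) * (1 + a)) :=
    mul_nonneg (by positivity) (InformationTheory.klFun_nonneg (by positivity))
  refine ⟨by unfold entTerm; linarith, fun h => ?_, fun h => ?_⟩
  · unfold entTerm at h
    have hz : a / (1 + a) * InformationTheory.klFun (r * (1 + a) / a) = 0 := by linarith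
    rw [mul_eq_zero, InformationTheory.klFun_eq_zero_iff (by positivity)] at hz
    rcases hz with hz | hz
    · exact absurd hz (by positivity)
    · rw [hs]
      field_simp at hz ⊢
      linarith
  · rw [hs] at h
    have e₁ : r * (1 + a) / a = 1 := by rw [h]; field_simp
    have e₂ : (1 - r) * (1 + a) = 1 := by rw [h]; field_simp; ring
    rw [e₁, InformationTheory.klFun_one] at hkl₁
    rw [e₂, InformationTheory.klFun_one] at hkl₂
    unfold entTerm
    linarith

lemma continuous_entTerm : Continuous entTerm := by
  unfold entTerm
  have h := Real.continuous_mul_log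
  exact (h.add (h.comp (continuous_const.sub continuous_id))).add continuous_const

instance : IsFiniteMeasure Leb01 := by unfold Leb01; infer_instance

lemma absolutelyContinuous_volume_of_le {μ : Measure ℝ} (h : μ ≤ Leb01) : μ ≪ volume :=
  (Measure.absolutelyContinuous_of_le h).trans Measure.absolutelyContinuous_restrict

lemma ae_mem_Icc_of_le {μ : Measure ℝ} (h : μ ≤ Leb01) : ∀ᵐ x ∂μ, x ∈ Icc (0:ℝ) 1 :=
  (Measure.absolutelyContinuous_of_le h).ae_le (ae_restrict_mem measurableSet_Icc)

lemma measurable_dens (μ : Measure ℝ) : Measurable (dens μ) :=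
  (Measure.measurable_rnDeriv _ _).ennreal_toReal

lemma dens_nonneg (μ : Measure ℝ) (x : ℝ) : 0 ≤ dens μ x := ENNReal.toReal_nonneg

lemma dens_le_one {μ : Measure ℝ} (h : μ ≤ Leb01) : ∀ᵐ x ∂Leb01, dens μ x ≤ 1 := by
  filter_upwards [ae_restrict_of_ae
    (Measure.rnDeriv_le_one_of_le (h.trans Measure.restrict_le_self))] with x hx
  exact ENNReal.toReal_mono ENNReal.one_ne_top hx

lemma withDensity_dens {μ : Measure ℝ} (h : μ ≤ Leb01) :
    μ = Leb01.withDensity (fun x => ENNReal.ofReal (dens μ x)) := by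
  have : IsFiniteMeasure μ := isFiniteMeasure_of_le _ h
  have h₁ : Leb01.withDensity (fun x => ENNReal.ofReal (dens μ x)) =
      Leb01.withDensity (μ.rnDeriv volume) := by
    refine withDensity_congr_ae (ae_restrict_of_ae ?_)
    filter_upwards [Measure.rnDeriv_lt_top μ volume] with x hx
    exact ENNReal.ofReal_toReal hx.ne
  rw [h₁, Leb01, ← restrict_withDensity measurableSet_Icc,
    Measure.withDensity_rnDeriv_eq _ _ (absolutelyContinuous_volume_of_le h),
    Measure.restrict_eq_self_of_ae_mem (ae_mem_Icc_of_le h)]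

lemma integral_dens_mul {μ : Measure ℝ} (h : μ ≤ Leb01) (f : ℝ → ℝ) :
    ∫ x, dens μ x * f x ∂Leb01 = ∫ x, f x ∂μ := by
  have : IsFiniteMeasure μ := isFiniteMeasure_of_le _ h
  have := setIntegral_toReal_rnDeriv_mul (f := f) (absolutelyContinuous_volume_of_le h)
    (measurableSet_Icc (a := (0:ℝ)) (b := 1))
  rwa [Measure.restrict_eq_self_of_ae_mem (ae_mem_Icc_of_le h)] at this

lemma dens_withDensity {f : ℝ → ℝ} (hf : Measurable f) (hf0 : ∀ x, 0 ≤ f x) :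
    dens (Leb01.withDensity fun x => ENNReal.ofReal (f x)) =ᵐ[Leb01] f := by
  have h₁ : Leb01.withDensity (fun x => ENNReal.ofReal (f x)) =
      volume.withDensity ((Icc (0:ℝ) 1).indicator fun x => ENNReal.ofReal (f x)) :=
    (withDensity_indicator measurableSet_Icc _).symm
  rw [h₁]
  filter_upwards [ae_restrict_of_ae (Measure.rnDeriv_withDensity volume
    (hf.ennreal_ofReal.indicator measurableSet_Icc)), ae_restrict_mem measurableSet_Icc]
    with x hx hmem
  rw [dens, hx, indicator_of_mem hmem, ENNReal.toReal_ofReal (hf0 x)]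

lemma integrable_dens_comp {μ : Measure ℝ} (h : μ ≤ Leb01) {g : ℝ → ℝ → ℝ}
    (hg : Continuous fun z : ℝ × ℝ => g z.1 z.2) :
    Integrable (fun x => g x (dens μ x)) Leb01 := by
  obtain ⟨C, hC⟩ := ((isCompact_Icc (a := (0:ℝ)) (b := 1)).prod
    (isCompact_Icc (a := (0:ℝ)) (b := 1))).exists_bound_of_continuousOn hg.continuousOn
  refine Integrable.of_bound
    (hg.measurable.comp (measurable_id.prodMk (measurable_dens μ))).aestronglyMeasurable C ?_
  filter_upwards [dens_le_one h, ae_restrict_mem measurableSet_Icc] with x hx hmem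
  exact hC (x, dens μ x) ⟨hmem, dens_nonneg μ x, hx⟩

lemma measure_Icc_add_Ioi {μ : Measure ℝ} (h : μ ≤ Leb01) (x : ℝ) :
    μ (Icc 0 x) + μ (Ioi x) = μ univ := by
  have h₁ : μ (Icc 0 x) = μ (Iic x) := by
    refine measure_congr ?_
    filter_upwards [ae_mem_Icc_of_le h] with y hy
    exact propext ⟨fun hz => hz.2, fun hz => ⟨hy.1, hz⟩⟩
  rw [h₁, ← measure_add_measure_compl (μ := μ) (measurableSet_Iic (a := x)), compl_Iic]

lemma measure_Ioi_le_of_measure_Icc_le {μ ν : Measure ℝ} (hμ : μ ≤ Leb01) (hν : ν ≤ Leb01)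
    (huniv : μ univ = ν univ) {x : ℝ} (h : μ (Icc 0 x) ≤ ν (Icc 0 x)) :
    ν (Ioi x) ≤ μ (Ioi x) := by
  have : IsFiniteMeasure ν := isFiniteMeasure_of_le _ hν
  refine (ENNReal.add_le_add_iff_left (measure_ne_top ν (Icc 0 x))).1 ?_
  rw [measure_Icc_add_Ioi hν, ← huniv, ← measure_Icc_add_Ioi hμ x]
  gcongr

lemma integrable_id_of_le {μ : Measure ℝ} (h : μ ≤ Leb01) : Integrable (fun x : ℝ => x) μ := by
  have : IsFiniteMeasure μ := isFiniteMeasure_of_le _ h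
  refine Integrable.of_bound measurable_id.aestronglyMeasurable 1 ?_
  filter_upwards [ae_mem_Icc_of_le h] with x hx
  rw [Real.norm_eq_abs, abs_of_nonneg hx.1]
  exact hx.2

/-- The measure with the larger cumulative distribution function has the smaller mean. -/
lemma integral_id_le {q : Measure ℝ × Measure ℝ} (hq : q ∈ Dset) :
    ∫ x, x ∂q.2 ≤ ∫ x, x ∂q.1 := by
  obtain ⟨h1, h2, hu, hc⟩ := hq
  have : IsFiniteMeasure q.1 := isFiniteMeasure_of_le _ h1
  have nn₁ : 0 ≤ᵐ[q.1] fun x : ℝ => x := (ae_mem_Icc_of_le h1).mono fun x hx => hx.1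
  have nn₂ : 0 ≤ᵐ[q.2] fun x : ℝ => x := (ae_mem_Icc_of_le h2).mono fun x hx => hx.1
  rw [integral_eq_lintegral_of_nonneg_ae nn₁ measurable_id.aestronglyMeasurable,
    integral_eq_lintegral_of_nonneg_ae nn₂ measurable_id.aestronglyMeasurable]
  refine ENNReal.toReal_mono (integrable_id_of_le h1).lintegral_lt_top.ne ?_
  rw [lintegral_eq_lintegral_meas_lt _ nn₁ aemeasurable_id',
    lintegral_eq_lintegral_meas_lt _ nn₂ aemeasurable_id']
  exact lintegral_mono fun t => measure_Ioi_le_of_measure_Icc_le h1 h2 hu (hc t)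

lemma measurable_logistic (c : ℝ) :
    Measurable fun x : ℝ => 1 / (1 + Real.exp (c * (1 / 2 - x))) := by
  fun_prop

lemma dens_logisticMeasure (c : ℝ) :
    dens (logisticMeasure c) =ᵐ[Leb01] fun x => 1 / (1 + Real.exp (c * (1 / 2 - x))) :=
  dens_withDensity (measurable_logistic c) fun x => by positivity

lemma logisticMeasure_le (c : ℝ) : logisticMeasure c ≤ Leb01 := by
  have h : logisticMeasure c ≤ Leb01.withDensity 1 := by
    refine withDensity_mono (Eventually.of_forall fun x => ENNReal.ofReal_le_one.2 ?_)
    rw [div_le_one (by positivity)]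
    linarith [Real.exp_pos (c * (1 / 2 - x))]
  rwa [withDensity_one] at h

lemma logisticMeasure_univ (c : ℝ) : logisticMeasure c univ = ENNReal.ofReal (1 / 2) := by
  set s : ℝ → ℝ := fun x => 1 / (1 + Real.exp (c * (1 / 2 - x))) with hs
  have hcont : Continuous s := by
    refine continuous_const.div (by fun_prop) fun x => by positivity
  have hsum : ∀ x, s x + s (1 - x) = 1 := by
    intro x
    have e : c * (1 / 2 - (1 - x)) = -(c * (1 / 2 - x)) := by ring
    simp only [hs]
    rw [e, Real.exp_neg]
    have := Real.exp_pos (c * (1 / 2 - x))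
    field_simp
    ring
  have hrefl : ∫ x in (0:ℝ)..1, s (1 - x) = ∫ x in (0:ℝ)..1, s x := by
    simp [intervalIntegral.integral_comp_sub_left]
  have htot : (∫ x in (0:ℝ)..1, s x) + ∫ x in (0:ℝ)..1, s (1 - x) = 1 := by
    have hcont' : Continuous fun x => s (1 - x) :=
      hcont.comp (continuous_const.sub continuous_id)
    rw [← intervalIntegral.integral_add (hcont.intervalIntegrable _ _)
      (hcont'.intervalIntegrable _ _)]
    simp [hsum]
  have hhalf : ∫ x, s x ∂Leb01 = 1 / 2 := by
    rw [Leb01, integral_Icc_eq_integral_Ioc, ← intervalIntegral.integral_of_le zero_le_one]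
    linarith
  have hint : Integrable s Leb01 := hcont.continuousOn.integrableOn_compact isCompact_Icc
  rw [← hhalf, ofReal_integral_eq_lintegral_ofReal hint
      (Eventually.of_forall fun x => by simp only [hs, Pi.zero_apply]; positivity),
    logisticMeasure, withDensity_apply _ MeasurableSet.univ, Measure.restrict_univ]

lemma logisticMeasure_apply (c : ℝ) {s : Set ℝ} (hs : MeasurableSet s) :
    logisticMeasure c s =
      ∫⁻ x in s, ENNReal.ofReal (1 / (1 + Real.exp (c * (1 / 2 - x)))) ∂Leb01 :=
  withDensity_apply _ hs

lemma logisticMeasure_mem_Dset {c : ℝ} (hc : 0 ≤ c) :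
    (logisticMeasure c, logisticMeasure (-c)) ∈ Dset := by
  have huniv : logisticMeasure c univ = logisticMeasure (-c) univ := by
    rw [logisticMeasure_univ, logisticMeasure_univ]
  refine ⟨logisticMeasure_le _, logisticMeasure_le _, huniv, fun x => ?_⟩
  change logisticMeasure c (Icc 0 x) ≤ logisticMeasure (-c) (Icc 0 x)
  rcases le_total x (1 / 2) with hx | hx
  · rw [logisticMeasure_apply _ measurableSet_Icc, logisticMeasure_apply _ measurableSet_Icc]
    refine setLIntegral_mono (measurable_logistic _).ennreal_ofReal fun y hy => ?_
    have : 0 ≤ c * (1 / 2 - y) := mul_nonneg hc (by linarith [hy.2])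
    refine ENNReal.ofReal_le_ofReal (one_div_le_one_div_of_le (by positivity) ?_)
    gcongr 1 + Real.exp ?_
    linarith
  · have hIoi : logisticMeasure (-c) (Ioi x) ≤ logisticMeasure c (Ioi x) := by
      rw [logisticMeasure_apply _ measurableSet_Ioi, logisticMeasure_apply _ measurableSet_Ioi]
      refine setLIntegral_mono (measurable_logistic _).ennreal_ofReal fun y hy => ?_
      have : c * (1 / 2 - y) ≤ 0 :=
        mul_nonpos_of_nonneg_of_nonpos hc (by linarith [mem_Ioi.1 hy])
      refine ENNReal.ofReal_le_ofReal (one_div_le_one_div_of_le (by positivity) ?_)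
      gcongr 1 + Real.exp ?_
      linarith
    have : IsFiniteMeasure (logisticMeasure c) := isFiniteMeasure_of_le _ (logisticMeasure_le c)
    refine (ENNReal.add_le_add_iff_right (measure_ne_top (logisticMeasure c) (Ioi x))).1 ?_
    rw [measure_Icc_add_Ioi (logisticMeasure_le c), huniv,
      ← measure_Icc_add_Ioi (logisticMeasure_le (-c)) x]
    gcongr

/-- The integrand of the action with the tilt `c (x - 1/2)` absorbed. -/
def tiltedEntropy (c x r : ℝ) : ℝ := entTerm r - c * (x - 1 / 2) * r

/-- The pointwise minimum over `r` of `tiltedEntropy c x r`. -/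
def tiltedMin (c x : ℝ) : ℝ := Real.log 2 - Real.log (1 + Real.exp (c * (x - 1 / 2)))

lemma tiltedMin_le (c x : ℝ) {r : ℝ} (h0 : 0 ≤ r) (h1 : r ≤ 1) :
    tiltedMin c x ≤ tiltedEntropy c x r :=
  (entTerm_gibbs _ h0 h1).1

lemma tiltedEntropy_eq_tiltedMin_iff (c x : ℝ) {r : ℝ} (h0 : 0 ≤ r) (h1 : r ≤ 1) :
    tiltedEntropy c x r = tiltedMin c x ↔ r = 1 / (1 + Real.exp (c * (1 / 2 - x))) := by
  have e : c * (1 / 2 - x) = -(c * (x - 1 / 2)) := by ring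
  rw [e]
  exact (entTerm_gibbs _ h0 h1).2

lemma integrable_tiltedEntropy (c : ℝ) {μ : Measure ℝ} (h : μ ≤ Leb01) :
    Integrable (fun x => tiltedEntropy c x (dens μ x)) Leb01 := by
  refine integrable_dens_comp h ?_
  unfold tiltedEntropy
  exact (continuous_entTerm.comp continuous_snd).sub (by fun_prop)

lemma integrable_tiltedMin (c : ℝ) : Integrable (tiltedMin c) Leb01 := by
  have : Continuous (tiltedMin c) :=
    continuous_const.sub (Continuous.log (by fun_prop) fun x => by positivity)
  exact this.continuousOn.integrableOn_compact isCompact_Icc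

lemma integral_tiltedMin_le (c : ℝ) {μ : Measure ℝ} (h : μ ≤ Leb01) :
    ∫ x, tiltedMin c x ∂Leb01 ≤ ∫ x, tiltedEntropy c x (dens μ x) ∂Leb01 := by
  refine integral_mono_ae (integrable_tiltedMin c) (integrable_tiltedEntropy c h) ?_
  filter_upwards [dens_le_one h] with x hx
  exact tiltedMin_le c x (dens_nonneg μ x) hx

lemma integral_tiltedEntropy_logisticMeasure (c : ℝ) :
    ∫ x, tiltedEntropy c x (dens (logisticMeasure c) x) ∂Leb01 = ∫ x, tiltedMin c x ∂Leb01 := by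
  refine integral_congr_ae ?_
  filter_upwards [dens_le_one (logisticMeasure_le c), dens_logisticMeasure c] with x h1 hx
  exact (tiltedEntropy_eq_tiltedMin_iff c x (dens_nonneg _ x) h1).2 hx

lemma eq_logisticMeasure_of_integral_le (c : ℝ) {μ : Measure ℝ} (h : μ ≤ Leb01)
    (hle : ∫ x, tiltedEntropy c x (dens μ x) ∂Leb01 ≤ ∫ x, tiltedMin c x ∂Leb01) :
    μ = logisticMeasure c := by
  have hae : tiltedMin c ≤ᵐ[Leb01] fun x => tiltedEntropy c x (dens μ x) := by
    filter_upwards [dens_le_one h] with x hx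
    exact tiltedMin_le c x (dens_nonneg μ x) hx
  have heq := (integral_eq_iff_of_ae_le (integrable_tiltedMin c)
    (integrable_tiltedEntropy c h) hae).1 (le_antisymm (integral_tiltedMin_le c h) hle)
  rw [withDensity_dens h, logisticMeasure]
  refine withDensity_congr_ae ?_
  filter_upwards [heq, dens_le_one h] with x hx h1
  rw [(tiltedEntropy_eq_tiltedMin_iff c x (dens_nonneg μ x) h1).1 hx.symm]

/-- On `Dset`, the action splits into a tilted entropy for each component plus a multiple of the
difference of the means. -/
lemma A321_eq (β c : ℝ) {q : Measure ℝ × Measure ℝ} (hq : q ∈ Dset) :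
    A321 β q = (∫ x, tiltedEntropy c x (dens q.1 x) ∂Leb01) +
      (∫ x, tiltedEntropy (-c) x (dens q.2 x) ∂Leb01) +
      (c - β) * ((∫ x, x ∂q.1) - ∫ x, x ∂q.2) := by
  obtain ⟨h1, h2, hu, -⟩ := hq
  have hmass : ∫ x, dens q.1 x ∂Leb01 = ∫ x, dens q.2 x ∂Leb01 := by
    have e₁ := integral_dens_mul h1 (fun _ => 1)
    have e₂ := integral_dens_mul h2 (fun _ => 1)
    simp only [mul_one] at e₁ e₂
    rw [e₁, e₂]
    simp [measureReal_def, hu]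
  have hent : ∀ {μ : Measure ℝ}, μ ≤ Leb01 → Integrable (fun x => entTerm (dens μ x)) Leb01 :=
    fun h => integrable_dens_comp (g := fun _ r => entTerm r) h
      (continuous_entTerm.comp continuous_snd)
  have hden : ∀ {μ : Measure ℝ}, μ ≤ Leb01 → Integrable (dens μ) Leb01 :=
    fun h => integrable_dens_comp (g := fun _ r => r) h continuous_snd
  have hmul : ∀ {μ : Measure ℝ}, μ ≤ Leb01 → Integrable (fun x => dens μ x * x) Leb01 :=
    fun h => integrable_dens_comp (g := fun x r => r * x) h (by fun_prop)
  have htilt : ∀ (a : ℝ) {μ : Measure ℝ}, μ ≤ Leb01 →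
      ∫ x, tiltedEntropy a x (dens μ x) ∂Leb01 =
        (∫ x, entTerm (dens μ x) ∂Leb01) - a * (∫ x, x ∂μ) +
          a / 2 * ∫ x, dens μ x ∂Leb01 := by
    intro a μ h
    have hsub : Integrable (fun x => entTerm (dens μ x) - a * (dens μ x * x)) Leb01 :=
      (hent h).sub ((hmul h).const_mul a)
    rw [← integral_dens_mul h, ← integral_const_mul, ← integral_const_mul,
      ← integral_sub (hent h) ((hmul h).const_mul a),
      ← integral_add hsub ((hden h).const_mul (a / 2))]
    refine integral_congr_ae (Eventually.of_forall fun x => ?_)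
    simp only [tiltedEntropy]
    ring
  have hH : H321 q = (∫ x, entTerm (dens q.1 x) ∂Leb01) + ∫ x, entTerm (dens q.2 x) ∂Leb01 :=
    integral_add (hent h1) (hent h2)
  have hM : ∫ x in Icc (0:ℝ) 1, x * (dens q.1 x - dens q.2 x) =
      (∫ x, x ∂q.1) - ∫ x, x ∂q.2 := by
    rw [← integral_dens_mul h1, ← integral_dens_mul h2, ← integral_sub (hmul h1) (hmul h2)]
    refine integral_congr_ae (Eventually.of_forall fun x => ?_)
    simp only
    ring
  rw [A321, hH, hM, htilt _ h1, htilt _ h2, hmass]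
  ring

lemma logisticMeasure_zero : logisticMeasure 0 = (2 : ENNReal)⁻¹ • Leb01 := by
  have h : ENNReal.ofReal (1 / (1 + 1)) = 2⁻¹ := by
    rw [one_div, ENNReal.ofReal_inv_of_pos (by norm_num)]
    norm_num
  simp only [logisticMeasure, zero_mul, Real.exp_zero, h, withDensity_const]

/-- The action `A_β` has a unique minimizer on `D`; it is `(½Leb, ½Leb)` for `β ≤ 0`,
and has the explicit logistic densities for `β > 0` (in which case both components
have total mass `1/2`). -/
theorem unique_minimizer_action_321 (β : ℝ) :
    ∃ p : Measure ℝ × Measure ℝ, p ∈ Dset ∧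
      (∀ q ∈ Dset, A321 β p ≤ A321 β q) ∧
      (∀ q ∈ Dset, (∀ r ∈ Dset, A321 β q ≤ A321 β r) → q = p) ∧
      (β ≤ 0 →
        p.1 = (2 : ENNReal)⁻¹ • Leb01 ∧ p.2 = (2 : ENNReal)⁻¹ • Leb01) ∧
      (0 < β →
        p.1 = Leb01.withDensity
          (fun x => ENNReal.ofReal (1 / (1 + Real.exp (β * (1 / 2 - x))))) ∧
        p.2 = Leb01.withDensity
          (fun x => ENNReal.ofReal (1 / (1 + Real.exp (β * (x - 1 / 2))))) ∧
        p.1 Set.univ = ENNReal.ofReal (1 / 2) ∧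
        p.2 Set.univ = ENNReal.ofReal (1 / 2)) := by
  set c := max β 0 with hc
  have hc0 : 0 ≤ c := le_max_right _ _
  have hcβ : 0 ≤ c - β := sub_nonneg.2 (le_max_left _ _)
  have hp := logisticMeasure_mem_Dset hc0
  have hval : A321 β (logisticMeasure c, logisticMeasure (-c)) =
      (∫ x, tiltedMin c x ∂Leb01) + ∫ x, tiltedMin (-c) x ∂Leb01 := by
    have hzero : (c - β) *
        ((∫ x, x ∂logisticMeasure c) - ∫ x, x ∂logisticMeasure (-c)) = 0 := by
      rcases le_total β 0 with h | h
      · simp [hc, max_eq_right h]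
      · simp [hc, max_eq_left h]
    rw [A321_eq β c hp, integral_tiltedEntropy_logisticMeasure,
      integral_tiltedEntropy_logisticMeasure, hzero, add_zero]
  have hlow : ∀ q ∈ Dset, (∫ x, tiltedEntropy c x (dens q.1 x) ∂Leb01) +
      (∫ x, tiltedEntropy (-c) x (dens q.2 x) ∂Leb01) ≤ A321 β q := by
    intro q hq
    rw [A321_eq β c hq]
    have := mul_nonneg hcβ (sub_nonneg.2 (integral_id_le hq))
    linarith
  refine ⟨(logisticMeasure c, logisticMeasure (-c)), hp, fun q hq => ?_, fun q hq hmin => ?_,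
    fun hβ => ?_, fun hβ => ?_⟩
  · have h₁ := integral_tiltedMin_le c hq.1
    have h₂ := integral_tiltedMin_le (-c) hq.2.1
    linarith [hlow q hq]
  · have h₁ := integral_tiltedMin_le c hq.1
    have h₂ := integral_tiltedMin_le (-c) hq.2.1
    have h₃ := hlow q hq
    have h₄ := hmin _ hp
    exact Prod.ext (eq_logisticMeasure_of_integral_le c hq.1 (by linarith))
      (eq_logisticMeasure_of_integral_le (-c) hq.2.1 (by linarith))
  · rw [hc, max_eq_right hβ, neg_zero]
    exact ⟨logisticMeasure_zero, logisticMeasure_zero⟩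
  · have e : ∀ x : ℝ, -β * (1 / 2 - x) = β * (x - 1 / 2) := fun x => by ring
    rw [hc, max_eq_left hβ.le]
    refine ⟨rfl, ?_, logisticMeasure_univ _, logisticMeasure_univ _⟩
    simp only [logisticMeasure, e]

end
end
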